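/- Let X be a closed connected surface with a continuous involution σ whose fixed-point set is a disjoint union of g+1 circles, where X has genus g (Euler characteristic 2 − 2g). Then the complement X \ X^σ is disconnected. -/

import Mathlib

open CategoryTheory

/-- The singular chain complex of a topological space with coefficients in `R`. -/
noncomputable def singularChainComplex (R : Type) [CommRing R] :
    TopCat ⥤ ChainComplex (ModuleCat R) ℕ :=
  TopCat.toSSet ⋙ ((SimplicialObject.whiskering _ _).obj (ModuleCat.free R)) ⋙
    AlgebraicTopology.alternatingFaceMapComplex _

/-- Singular homology with coefficients in `R`, as a functor `TopCat ⥤ ModuleCat R`. -/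
noncomputable def singularHomology (R : Type) [CommRing R] (n : ℕ) :
    TopCat ⥤ ModuleCat R :=
  singularChainComplex R ⋙ HomologicalComplex.homologyFunctor _ _ n

/-- The `n`-th Betti number of a topological space with coefficients in `R`. -/
noncomputable def bettiNumber (R : Type) [CommRing R] (n : ℕ) (X : Type)
    [TopologicalSpace X] : ℕ :=
  Module.finrank R ((singularHomology R n).obj (TopCat.of X))

/-- The setoid on `Fin n → X` identifying tuples up to permutation. -/
def symmSetoid (X : Type) (n : ℕ) : Setoid (Fin n → X) where
  r x y := ∃ e : Equiv.Perm (Fin n), x ∘ e = y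
  iseqv := by
    refine ⟨fun x => ⟨Equiv.refl _, rfl⟩, ?_, ?_⟩
    · rintro x y ⟨e, rfl⟩
      exact ⟨e.symm, by ext i; simp⟩
    · rintro x y z ⟨e, rfl⟩ ⟨f, rfl⟩
      exact ⟨f.trans e, by ext i; simp⟩

/-- The `n`-th symmetric product of a topological space, with the quotient topology. -/
def SymProd (X : Type) [TopologicalSpace X] (n : ℕ) : Type :=
  Quotient (symmSetoid X n)

instance (X : Type) [TopologicalSpace X] (n : ℕ) : TopologicalSpace (SymProd X n) :=
  instTopologicalSpaceQuotient

namespace SurfaceHomology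

section SingularChains

open Finsupp

section Generic

variable {S S' S'' M : Type*} [AddCommGroup M] [Module ℚ M]

theorem hom_ext {f g : (S →₀ ℚ) →ₗ[ℚ] M} (h : ∀ s, f (single s 1) = g (single s 1)) : f = g :=
  Finsupp.lhom_ext' fun s => LinearMap.ext_ring (by simpa using h s)

theorem map_mem_of_supported {A : Set S} (f : (S →₀ ℚ) →ₗ[ℚ] M) (N : Submodule ℚ M)
    (h : ∀ s ∈ A, f (single s 1) ∈ N) {u : S →₀ ℚ} (hu : u ∈ supported ℚ ℚ A) : f u ∈ N := by
  rw [supported_eq_span_single] at hu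
  induction hu using Submodule.span_induction with
  | mem x hx => obtain ⟨s, hs, rfl⟩ := hx; exact h s hs
  | zero => simp
  | add x y _ _ hx hy => rw [map_add]; exact N.add_mem hx hy
  | smul c x _ hx => rw [map_smul]; exact N.smul_mem c hx

theorem eq_of_supported {A : Set S} (f g : (S →₀ ℚ) →ₗ[ℚ] M)
    (h : ∀ s ∈ A, f (single s 1) = g (single s 1)) {u : S →₀ ℚ} (hu : u ∈ supported ℚ ℚ A) :
    f u = g u := by
  have := map_mem_of_supported (f - g) ⊥ (by simpa [sub_eq_zero] using h) hu
  simpa [sub_eq_zero] using this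

/-- The alternating sum of faces. -/
noncomputable def altSum {n : ℕ} (d : Fin n → S' → S) : (S' →₀ ℚ) →ₗ[ℚ] (S →₀ ℚ) :=
  linearCombination ℚ fun s => ∑ i : Fin n, (-1 : ℚ) ^ (i : ℕ) • single (d i s) 1

theorem altSum_single {n : ℕ} (d : Fin n → S' → S) (s : S') :
    altSum d (single s 1) = ∑ i : Fin n, (-1 : ℚ) ^ (i : ℕ) • single (d i s) 1 := by
  simp [altSum]

theorem altSum_altSum {n : ℕ} (d : Fin (n + 2) → S' → S) (d' : Fin (n + 3) → S'' → S')
    (h : ∀ (i j : Fin (n + 2)), i ≤ j → ∀ s, d i (d' j.succ s) = d j (d' i.castSucc s))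
    (u : S'' →₀ ℚ) : altSum d (altSum d' u) = 0 := by
  suffices H : (altSum d).comp (altSum d') = 0 from DFunLike.congr_fun H u
  refine hom_ext fun s => ?_
  simp only [LinearMap.comp_apply, altSum_single, map_sum, map_smul, LinearMap.zero_apply,
    Finset.smul_sum, smul_smul]
  rw [← Finset.sum_product' (f := fun (x : Fin (n+3)) (i : Fin (n + 2)) =>
    ((-1 : ℚ) ^ (x : ℕ) * (-1) ^ (i : ℕ)) • single (d i (d' x s)) (1 : ℚ))]
  let P := Fin (n + 3) × Fin (n + 2)
  let T : Finset P := {ij : P | (ij.1 : ℕ) ≤ (ij.2 : ℕ)}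
  rw [Finset.univ_product_univ, ← Finset.sum_add_sum_compl T, ← eq_neg_iff_add_eq_zero,
    ← Finset.sum_neg_distrib]
  let φ : ∀ ij : P, ij ∈ T → P := fun ij hij =>
    (ij.2.succ, Fin.castLT ij.1 (lt_of_le_of_lt (Finset.mem_filter.mp hij).right (Fin.is_lt ij.2)))
  apply Finset.sum_bij φ
  · intro ij hij
    simp_rw [T, φ, Finset.compl_filter, Finset.mem_filter_univ, Fin.val_succ,
      Fin.val_castLT] at hij ⊢
    lia
  · rintro ⟨i, j⟩ hij ⟨i', j'⟩ hij' h
    rw [Prod.mk_inj]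
    exact ⟨by simpa [φ, Fin.castSucc_castLT] using! congr_arg Fin.castSucc (congr_arg Prod.snd h),
      by simpa [φ] using! congr_arg Prod.fst h⟩
  · rintro ⟨j', i'⟩ hij'
    simp_rw [T, Finset.compl_filter, Finset.mem_filter_univ, not_le] at hij'
    refine ⟨(Fin.castSucc i', j'.pred <| ?_), ?_, ?_⟩
    · rintro rfl
      simp only [Fin.val_zero, not_lt_zero] at hij'
    · simpa [T] using! Nat.le_sub_one_of_lt hij'
    · simp only [φ, Fin.castLT_castSucc, Fin.succ_pred]
  · rintro ⟨j, i⟩ hij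
    have hle : (j : ℕ) ≤ i := by simpa [T] using hij
    have := h (Fin.castLT j (lt_of_le_of_lt hle i.is_lt)) i (by simpa [Fin.le_def] using hle) s
    simp only [φ, Fin.val_succ, Fin.val_castLT]
    rw [← neg_smul, this]
    simp only [Fin.castSucc_castLT]
    congr 1
    ring

end Generic

/-- The standard simplex of dimension `n`. -/
abbrev Simp (n : ℕ) : Type := stdSimplex ℝ (Fin (n + 1))

/-- The continuous map of standard simplices induced by a map on vertices. -/
noncomputable def smap {m n : ℕ} (f : Fin (m + 1) → Fin (n + 1)) : C(Simp m, Simp n) :=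
  ⟨stdSimplex.map f, stdSimplex.continuous_map f⟩

theorem smap_comp {l m n : ℕ} (f : Fin (m + 1) → Fin (n + 1)) (g : Fin (l + 1) → Fin (m + 1)) :
    (smap f).comp (smap g) = smap (f ∘ g) := by
  ext1 x
  exact stdSimplex.map_comp_apply g f x

/-- The vertices of the standard simplex. -/
noncomputable abbrev vtx {n : ℕ} (i : Fin (n + 1)) : Simp n := stdSimplex.vertex i

theorem smap_vtx {m n : ℕ} (f : Fin (m + 1) → Fin (n + 1)) (i : Fin (m + 1)) :
    smap f (vtx i) = vtx (f i) := stdSimplex.map_vertex f i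

theorem succAbove_comp {n : ℕ} {i j : Fin (n + 2)} (h : i ≤ j) :
    j.succ.succAbove ∘ i.succAbove = i.castSucc.succAbove ∘ j.succAbove := by
  ext k
  simp only [Function.comp, Fin.succAbove, Fin.lt_def, Fin.le_def] at *
  grind

variable {X Y W : Type*} [TopologicalSpace X] [TopologicalSpace Y] [TopologicalSpace W]

/-- Singular chains with rational coefficients. -/
abbrev SC (n : ℕ) (X : Type*) [TopologicalSpace X] : Type _ := C(Simp n, X) →₀ ℚ

/-- Faces of a singular simplex. -/
noncomputable def face {n : ℕ} (i : Fin (n + 2)) (σ : C(Simp (n + 1), X)) : C(Simp n, X) :=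
  σ.comp (smap i.succAbove)

/-- The singular boundary operator. -/
noncomputable def bd {n : ℕ} : SC (n + 1) X →ₗ[ℚ] SC n X := altSum face

theorem bd_single {n : ℕ} (σ : C(Simp (n + 1), X)) :
    bd (single σ 1) = ∑ i : Fin (n + 2), (-1 : ℚ) ^ (i : ℕ) • single (face i σ) 1 :=
  altSum_single _ _

theorem bd_bd {n : ℕ} (u : SC (n + 2) X) : bd (bd u) = 0 := by
  refine altSum_altSum _ _ (fun i j hij σ => ?_) u
  simp only [face, ContinuousMap.comp_assoc, smap_comp, succAbove_comp hij]

/-- Pushforward of singular chains. -/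
noncomputable def push {n : ℕ} (f : C(X, Y)) : SC n X →ₗ[ℚ] SC n Y :=
  Finsupp.lmapDomain ℚ ℚ fun σ => f.comp σ

@[simp]
theorem push_single {n : ℕ} (f : C(X, Y)) (σ : C(Simp n, X)) (c : ℚ) :
    push f (single σ c) = single (f.comp σ) c := by
  simp [push, Finsupp.mapDomain_single]

theorem push_push {n : ℕ} (f : C(X, Y)) (g : C(Y, W)) (u : SC n X) :
    push g (push f u) = push (g.comp f) u := by
  suffices H : (push g).comp (push f) = push (n := n) (g.comp f) from DFunLike.congr_fun H u
  exact hom_ext fun σ => by simp [ContinuousMap.comp_assoc]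

theorem push_id {n : ℕ} (u : SC n X) : push (ContinuousMap.id X) u = u := by
  suffices H : push (n := n) (ContinuousMap.id X) = LinearMap.id from DFunLike.congr_fun H u
  exact hom_ext fun σ => by simp

theorem bd_push {n : ℕ} (f : C(X, Y)) (u : SC (n + 1) X) : bd (push f u) = push f (bd u) := by
  suffices H : bd.comp (push f) = (push (n := n) f).comp bd from DFunLike.congr_fun H u
  refine hom_ext fun σ => ?_
  simp [bd_single, face, ContinuousMap.comp_assoc]

/-- Chains supported in a subset. -/
noncomputable def Chn (n : ℕ) (S : Set X) : Submodule ℚ (SC n X) :=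
  supported ℚ ℚ {σ | ∀ t, σ t ∈ S}

theorem single_mem_Chn {n : ℕ} {S : Set X} {σ : C(Simp n, X)} (h : ∀ t, σ t ∈ S) (c : ℚ) :
    single σ c ∈ Chn n S := single_mem_supported ℚ c h

theorem Chn_mono {n : ℕ} {S T : Set X} (h : S ⊆ T) : Chn n S ≤ Chn n T :=
  supported_mono fun _ hσ t => h (hσ t)

theorem Chn_inter {n : ℕ} {S T : Set X} {u : SC n X} (h : u ∈ Chn n S) (h' : u ∈ Chn n T) :
    u ∈ Chn n (S ∩ T) := fun _ hσ t => ⟨h hσ t, h' hσ t⟩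

theorem mem_Chn_univ {n : ℕ} (u : SC n X) : u ∈ Chn n (Set.univ : Set X) :=
  fun _ _ _ => trivial

theorem bd_mem {n : ℕ} {S : Set X} {u : SC (n + 1) X} (h : u ∈ Chn (n + 1) S) :
    bd u ∈ Chn n S := by
  refine map_mem_of_supported bd _ (fun σ hσ => ?_) h
  rw [bd_single]
  exact Submodule.sum_mem _ fun i _ => Submodule.smul_mem _ _
    (single_mem_Chn (fun t => hσ (smap i.succAbove t)) _)

theorem push_mem {n : ℕ} {S : Set X} {T : Set Y} {f : C(X, Y)} (hf : ∀ x ∈ S, f x ∈ T)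
    {u : SC n X} (h : u ∈ Chn n S) : push f u ∈ Chn n T := by
  refine map_mem_of_supported _ _ (fun σ hσ => ?_) h
  rw [push_single]
  exact single_mem_Chn (fun t => hf _ (hσ t)) _

/-- The image of a chain, a compact set. -/
def carrier {n : ℕ} (u : SC n X) : Set X := ⋃ σ ∈ u.support, Set.range σ

theorem isCompact_carrier {n : ℕ} (u : SC n X) : IsCompact (carrier u) :=
  u.support.finite_toSet.isCompact_biUnion fun σ _ => isCompact_range σ.continuous

theorem mem_Chn_iff {n : ℕ} {u : SC n X} {S : Set X} : u ∈ Chn n S ↔ carrier u ⊆ S := by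
  simp only [carrier, Set.iUnion_subset_iff, Set.range_subset_iff]
  rfl

end SingularChains

section Subdivision

open Finsupp

/-- Convex combination of points of a simplex. -/
noncomputable def comb {n m : ℕ} (v : Fin (n + 1) → Simp m) (t : Simp n) : Simp m :=
  ⟨∑ i, t i • (v i : Fin (m + 1) → ℝ),
    (convex_stdSimplex ℝ (Fin (m + 1))).sum_mem (fun i _ => t.2.1 i) t.2.2 fun i _ => (v i).2⟩

theorem comb_apply {n m : ℕ} (v : Fin (n + 1) → Simp m) (t : Simp n) (j : Fin (m + 1)) :
    comb v t j = ∑ i, t i * v i j := by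
  change (∑ i, t i • (v i : Fin (m + 1) → ℝ)) j = _
  simp [Finset.sum_apply]

/-- The affine singular simplex with given vertices. -/
noncomputable def combC {n m : ℕ} (v : Fin (n + 1) → Simp m) : C(Simp n, Simp m) where
  toFun := comb v
  continuous_toFun := by
    refine Continuous.subtype_mk (continuous_finsetSum _ fun i _ => ?_) _
    exact ((continuous_apply i).comp continuous_subtype_val).smul continuous_const

theorem combC_vtx (n : ℕ) : combC (vtx : Fin (n + 1) → Simp n) = ContinuousMap.id _ := by
  ext t j
  change comb _ t j = t j
  rw [comb_apply]
  simp [Pi.single_apply]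

theorem combC_comp {l n m : ℕ} (v : Fin (n + 1) → Simp m) (w : Fin (l + 1) → Simp n) :
    (combC v).comp (combC w) = combC (comb v ∘ w) := by
  ext t j
  change comb v (comb w t) j = comb (comb v ∘ w) t j
  simp only [comb_apply, Function.comp, Finset.sum_mul, Finset.mul_sum]
  rw [Finset.sum_comm]
  simp only [mul_assoc]

theorem combC_smap {l n m : ℕ} (v : Fin (n + 1) → Simp m) (f : Fin (l + 1) → Fin (n + 1)) :
    (combC v).comp (smap f) = combC (v ∘ f) := by
  ext t j
  change comb v (stdSimplex.map f t) j = comb (v ∘ f) t j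
  simp only [comb_apply, stdSimplex.map_coe, FunOnFinite.linearMap_apply_apply]
  simp only [Finset.sum_mul]
  rw [← Finset.sum_fiberwise (g := f) (s := Finset.univ)]
  refine Finset.sum_congr rfl fun i _ => Finset.sum_congr rfl fun k hk => ?_
  simp at hk
  simp [hk]

theorem comb_vtx {n m : ℕ} (v : Fin (n + 1) → Simp m) : comb v ∘ vtx = v := by
  ext i j
  change comb v (vtx i) j = _
  rw [comb_apply]
  simp [Pi.single_apply]

theorem dist_comb_le {n m : ℕ} {v : Fin (n + 1) → Simp m} {c : Simp m} {r : ℝ}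
    (h : ∀ i, dist (v i) c ≤ r) (t : Simp n) : dist (comb v t) c ≤ r := by
  have := (convex_closedBall (c : Fin (m + 1) → ℝ) r).sum_mem (t := Finset.univ)
    (w := fun i => t i) (z := fun i => (v i : Fin (m + 1) → ℝ)) (fun i _ => t.2.1 i) t.2.2
    fun i _ => h i
  exact this

/-- Barycenter of a tuple. -/
noncomputable def bary {n m : ℕ} (v : Fin (n + 1) → Simp m) : Simp m :=
  comb v stdSimplex.barycenter

theorem dist_bary_le {n m : ℕ} {v : Fin (n + 2) → Simp m} {d : ℝ}
    (h : ∀ i j, dist (v i) (v j) ≤ d) (i : Fin (n + 2)) :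
    dist (v i) (bary v) ≤ (n + 1) / (n + 2) * d := by
  have h1 : (bary v).1 - (v i).1 = ∑ j, (1 / (n + 2) : ℝ) • ((v j).1 - (v i).1) := by
    ext k
    change bary v k - v i k = _
    rw [bary, comb_apply]
    simp only [Finset.sum_apply, Pi.smul_apply, Pi.sub_apply, smul_eq_mul, mul_sub,
      Finset.sum_sub_distrib]
    simp only [Finset.sum_const, Finset.card_univ, Fintype.card_fin, nsmul_eq_mul]
    congr 1
    · refine Finset.sum_congr rfl fun j _ => ?_
      congr 1
      refine (stdSimplex.barycenter_apply (𝕜 := ℝ) j).trans ?_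
      rw [Fintype.card_fin]
      push_cast
      ring
    · push_cast
      field_simp
      rfl
  rw [dist_comm, Subtype.dist_eq, dist_eq_norm, h1,
    ← Finset.add_sum_erase _ _ (Finset.mem_univ i)]
  simp only [sub_self, smul_zero, zero_add]
  refine (norm_sum_le_of_le (f := fun j => (1 / (n + 2) : ℝ) • ((v j).1 - (v i).1))
    _ (n := fun _ => (1 / (n + 2) : ℝ) * d) fun j _ => ?_).trans ?_
  · rw [norm_smul, ← dist_eq_norm, Real.norm_of_nonneg (by positivity)]
    exact mul_le_mul_of_nonneg_left (h j i) (by positivity)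
  · rw [Finset.sum_const, Finset.card_erase_of_mem (Finset.mem_univ i)]
    simp
    apply le_of_eq
    field_simp

/-- Linear chains in a simplex. -/
abbrev LC (n m : ℕ) : Type := (Fin (n + 1) → Simp m) →₀ ℚ

noncomputable def lbd {n m : ℕ} : LC (n + 1) m →ₗ[ℚ] LC n m :=
  altSum fun i v => v ∘ i.succAbove

theorem lbd_single {n m : ℕ} (v : Fin (n + 2) → Simp m) :
    lbd (single v 1) = ∑ i : Fin (n + 2), (-1 : ℚ) ^ (i : ℕ) • single (v ∘ i.succAbove) 1 :=
  altSum_single _ _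

theorem lbd_lbd {n m : ℕ} (u : LC (n + 2) m) : lbd (lbd u) = 0 := by
  refine altSum_altSum _ _ (fun i j hij σ => ?_) u
  simp only [Function.comp_assoc, succAbove_comp hij]

noncomputable def cone {n m : ℕ} (o : Simp m) : LC n m →ₗ[ℚ] LC (n + 1) m :=
  lmapDomain ℚ ℚ fun v => Fin.cons o v

theorem cone_single {n m : ℕ} (o : Simp m) (v : Fin (n + 1) → Simp m) (c : ℚ) :
    cone o (single v c) = single (Fin.cons o v) c := by
  simp [cone, mapDomain_single]

theorem lbd_cone_succ {n m : ℕ} (o : Simp m) (u : LC (n + 1) m) :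
    lbd (cone o u) = u - cone o (lbd u) := by
  suffices H : lbd.comp (cone o) = LinearMap.id - (cone (n := n) o).comp lbd from
    DFunLike.congr_fun H u
  refine hom_ext fun v => ?_
  simp only [LinearMap.comp_apply, cone_single, lbd_single, LinearMap.sub_apply,
    LinearMap.id_apply, map_sum, map_smul]
  rw [Fin.sum_univ_succ]
  simp only [Fin.val_zero, pow_zero, one_smul, Fin.val_succ, pow_succ, mul_neg, mul_one, neg_smul,
    Finset.sum_neg_distrib, sub_eq_add_neg]
  congr 2
  refine Finset.sum_congr rfl fun i _ => ?_
  congr 2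
  ext j : 1
  refine Fin.cases ?_ (fun k => ?_) j <;> simp

theorem lbd_cone_zero {m : ℕ} (o : Simp m) (v w : Fin 1 → Simp m) :
    lbd (cone o (single v 1 - single w 1)) = single v 1 - single w 1 := by
  have key : ∀ v : Fin 1 → Simp m,
      lbd (cone o (single v 1)) = single v 1 - single (fun _ => o) 1 := by
    intro v
    have h : (Fin.cons o v : Fin 2 → Simp m) ∘ (Fin.succAbove 1) = fun _ => o := by
      ext j : 1; fin_cases j; rfl
    have h' : (Fin.cons o v : Fin 2 → Simp m) ∘ (Fin.succAbove 0) = v := by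
      ext j : 1; fin_cases j; rfl
    rw [cone_single, lbd_single, Fin.sum_univ_two, h, h']
    simp [sub_eq_add_neg]
  rw [map_sub, map_sub, key, key]
  abel

noncomputable def lsd (m : ℕ) : ∀ n, LC n m →ₗ[ℚ] LC n m
  | 0 => LinearMap.id
  | n + 1 => linearCombination ℚ fun v => cone (bary v) (lsd m n (lbd (single v 1)))

noncomputable def lT (m : ℕ) : ∀ n, LC n m →ₗ[ℚ] LC (n + 1) m
  | 0 => 0
  | n + 1 => linearCombination ℚ fun v => cone (bary v) (single v 1 - lT m n (lbd (single v 1)))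

theorem lsd_single {n m : ℕ} (v : Fin (n + 2) → Simp m) :
    lsd m (n + 1) (single v 1) = cone (bary v) (lsd m n (lbd (single v 1))) := by
  simp [lsd]

theorem lT_single {n m : ℕ} (v : Fin (n + 2) → Simp m) :
    lT m (n + 1) (single v 1) = cone (bary v) (single v 1 - lT m n (lbd (single v 1))) := by
  simp [lT]

theorem lbd_lsd {m : ℕ} : ∀ {n : ℕ} (u : LC (n + 1) m), lbd (lsd m (n + 1) u) = lsd m n (lbd u)
  | 0, u => by
    suffices H : lbd.comp (lsd m 1) = (lsd m 0).comp lbd from DFunLike.congr_fun H u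
    refine hom_ext fun v => ?_
    rw [LinearMap.comp_apply, lsd_single, LinearMap.comp_apply, lbd_single, Fin.sum_univ_two]
    simp only [Fin.val_zero, pow_zero, one_smul, Fin.val_one, pow_one, neg_smul, lsd,
      LinearMap.id_apply, ← sub_eq_add_neg]
    exact lbd_cone_zero _ _ _
  | n + 1, u => by
    suffices H : lbd.comp (lsd m (n + 2)) = (lsd m (n + 1)).comp lbd from DFunLike.congr_fun H u
    refine hom_ext fun v => ?_
    rw [LinearMap.comp_apply, lsd_single, LinearMap.comp_apply, lbd_cone_succ, lbd_lsd, lbd_lbd]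
    simp

theorem lbd_lT {m : ℕ} : ∀ {n : ℕ} (u : LC (n + 1) m),
    lbd (lT m (n + 1) u) = u - lsd m (n + 1) u - lT m n (lbd u)
  | 0, u => by
    suffices H : lbd.comp (lT m 1) = LinearMap.id - lsd m 1 - (lT m 0).comp lbd from
      DFunLike.congr_fun H u
    refine hom_ext fun v => ?_
    rw [LinearMap.comp_apply, lT_single, lbd_cone_succ]
    simp only [LinearMap.sub_apply, LinearMap.comp_apply, lsd_single]
    simp [lT, lsd]
  | n + 1, u => by
    suffices H : lbd.comp (lT m (n + 2)) = LinearMap.id - lsd m (n + 2) - (lT m (n + 1)).comp lbd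
      from DFunLike.congr_fun H u
    refine hom_ext fun v => ?_
    rw [LinearMap.comp_apply, lT_single, lbd_cone_succ, map_sub, lbd_lT, lbd_lbd]
    simp only [LinearMap.sub_apply, LinearMap.comp_apply, lsd_single, LinearMap.id_apply, map_zero,
      sub_zero, sub_sub_cancel]
    abel

/-- Pushforward of linear chains along an affine map. -/
noncomputable def lpush {n l m : ℕ} (w : Fin (l + 1) → Simp m) : LC n l →ₗ[ℚ] LC n m :=
  lmapDomain ℚ ℚ (comb w ∘ ·)

theorem lpush_single {n l m : ℕ} (w : Fin (l + 1) → Simp m) (v : Fin (n + 1) → Simp l) (c : ℚ) :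
    lpush w (single v c) = single (comb w ∘ v) c := by
  simp [lpush, mapDomain_single]

theorem lpush_lbd {n l m : ℕ} (w : Fin (l + 1) → Simp m) (u : LC (n + 1) l) :
    lpush w (lbd u) = lbd (lpush w u) := by
  suffices H : (lpush w).comp lbd = lbd.comp (lpush (n := n + 1) w) from DFunLike.congr_fun H u
  refine hom_ext fun v => ?_
  simp [lbd_single, lpush_single, Function.comp_assoc]

theorem lpush_cone {n l m : ℕ} (w : Fin (l + 1) → Simp m) (o : Simp l) (u : LC n l) :
    lpush w (cone o u) = cone (comb w o) (lpush w u) := by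
  suffices H : (lpush w).comp (cone o) = (cone (comb w o)).comp (lpush (n := n) w) from
    DFunLike.congr_fun H u
  refine hom_ext fun v => ?_
  simp only [LinearMap.comp_apply, cone_single, lpush_single]
  congr 1
  ext j : 1
  refine Fin.cases ?_ (fun k => ?_) j <;> simp

theorem comb_bary {n l m : ℕ} (w : Fin (l + 1) → Simp m) (v : Fin (n + 1) → Simp l) :
    comb w (bary v) = bary (comb w ∘ v) :=
  DFunLike.congr_fun (combC_comp w v) _

theorem lpush_lsd {l m : ℕ} (w : Fin (l + 1) → Simp m) :
    ∀ {n : ℕ} (u : LC n l), lpush w (lsd l n u) = lsd m n (lpush w u)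
  | 0, u => rfl
  | n + 1, u => by
    suffices H : (lpush w).comp (lsd l (n + 1)) = (lsd m (n + 1)).comp (lpush w) from
      DFunLike.congr_fun H u
    refine hom_ext fun v => ?_
    simp only [LinearMap.comp_apply, lsd_single, lpush_cone, lpush_lsd, lpush_lbd, lpush_single,
      comb_bary]

theorem lpush_lT {l m : ℕ} (w : Fin (l + 1) → Simp m) :
    ∀ {n : ℕ} (u : LC n l), lpush w (lT l n u) = lT m n (lpush w u)
  | 0, u => by simp [lT]
  | n + 1, u => by
    suffices H : (lpush w).comp (lT l (n + 1)) = (lT m (n + 1)).comp (lpush w) from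
      DFunLike.congr_fun H u
    refine hom_ext fun v => ?_
    simp only [LinearMap.comp_apply, lT_single, lpush_cone, lpush_lT, lpush_lbd, lpush_single,
      comb_bary, map_sub]

/-- Realization of linear chains as singular chains. -/
noncomputable def real {n m : ℕ} : LC n m →ₗ[ℚ] SC n (Simp m) := lmapDomain ℚ ℚ combC

theorem real_single {n m : ℕ} (v : Fin (n + 1) → Simp m) (c : ℚ) :
    real (single v c) = single (combC v) c := by
  simp [real, mapDomain_single]

theorem bd_real {n m : ℕ} (u : LC (n + 1) m) : bd (real u) = real (lbd u) := by
  suffices H : bd.comp real = (real (n := n) (m := m)).comp lbd from DFunLike.congr_fun H u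
  refine hom_ext fun v => ?_
  simp [real_single, bd_single, lbd_single, face, combC_smap]

theorem push_real {n l m : ℕ} (w : Fin (l + 1) → Simp m) (u : LC n l) :
    push (combC w) (real u) = real (lpush w u) := by
  suffices H : (push (combC w)).comp real = real.comp (lpush (n := n) w) from
    DFunLike.congr_fun H u
  refine hom_ext fun v => ?_
  simp [real_single, lpush_single, combC_comp]

section Subdivision

variable {X Y : Type*} [TopologicalSpace X] [TopologicalSpace Y]

/-- Barycentric subdivision. -/
noncomputable def sd {n : ℕ} : SC n X →ₗ[ℚ] SC n X :=
  linearCombination ℚ fun σ => push σ (real (lsd n n (single vtx 1)))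

/-- The chain homotopy from the identity to subdivision. -/
noncomputable def sT {n : ℕ} : SC n X →ₗ[ℚ] SC (n + 1) X :=
  linearCombination ℚ fun σ => push σ (real (lT n n (single vtx 1)))

theorem sd_single {n : ℕ} (σ : C(Simp n, X)) :
    sd (single σ 1) = push σ (real (lsd n n (single vtx 1))) := by simp [sd]

theorem sT_single {n : ℕ} (σ : C(Simp n, X)) :
    sT (single σ 1) = push σ (real (lT n n (single vtx 1))) := by simp [sT]

theorem sd_real {n m : ℕ} (u : LC n m) : sd (real u) = real (lsd m n u) := by
  suffices H : sd.comp real = real.comp (lsd m n) from DFunLike.congr_fun H u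
  refine hom_ext fun v => ?_
  rw [LinearMap.comp_apply, real_single, sd_single, push_real, lpush_lsd, lpush_single, comb_vtx]
  rfl

theorem sT_real {n m : ℕ} (u : LC n m) : sT (real u) = real (lT m n u) := by
  suffices H : sT.comp real = real.comp (lT m n) from DFunLike.congr_fun H u
  refine hom_ext fun v => ?_
  rw [LinearMap.comp_apply, real_single, sT_single, push_real, lpush_lT, lpush_single, comb_vtx]
  rfl

theorem sd_push {n : ℕ} (f : C(X, Y)) (u : SC n X) : sd (push f u) = push f (sd u) := by
  suffices H : sd.comp (push f) = (push f).comp (sd (n := n)) from DFunLike.congr_fun H u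
  refine hom_ext fun σ => ?_
  simp [sd_single, push_push]

theorem sT_push {n : ℕ} (f : C(X, Y)) (u : SC n X) : sT (push f u) = push f (sT u) := by
  suffices H : sT.comp (push f) = (push f).comp (sT (n := n)) from DFunLike.congr_fun H u
  refine hom_ext fun σ => ?_
  simp [sT_single, push_push]

theorem single_eq_push {n : ℕ} (σ : C(Simp n, X)) :
    single σ (1 : ℚ) = push σ (real (single vtx 1)) := by
  rw [real_single, combC_vtx, push_single, ContinuousMap.comp_id]

theorem bd_sd {n : ℕ} (u : SC (n + 1) X) : bd (sd u) = sd (bd u) := by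
  suffices H : bd.comp sd = sd.comp (bd (n := n) (X := X)) from DFunLike.congr_fun H u
  refine hom_ext fun σ => ?_
  simp only [LinearMap.comp_apply]
  rw [single_eq_push, sd_push, sd_real, bd_push, bd_real, bd_push, bd_real, sd_push, sd_real,
    lbd_lsd]

theorem bd_sT {n : ℕ} (u : SC (n + 1) X) : bd (sT u) = u - sd u - sT (bd u) := by
  suffices H : bd.comp sT = LinearMap.id - sd - sT.comp (bd (n := n) (X := X)) from
    DFunLike.congr_fun H u
  refine hom_ext fun σ => ?_
  simp only [LinearMap.comp_apply, LinearMap.sub_apply, LinearMap.id_apply]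
  rw [single_eq_push]
  simp only [sd_push, sd_real, bd_push, bd_real, sT_push, sT_real, lbd_lT, map_sub]

theorem sd_zero (u : SC 0 X) : sd u = u := by
  suffices H : sd (n := 0) (X := X) = LinearMap.id from DFunLike.congr_fun H u
  refine hom_ext fun σ => ?_
  rw [sd_single]
  exact (single_eq_push σ).symm

theorem sd_mem {n : ℕ} {S : Set X} {u : SC n X} (h : u ∈ Chn n S) : sd u ∈ Chn n S := by
  refine map_mem_of_supported _ _ (fun σ hσ => ?_) h
  rw [sd_single]
  exact push_mem (S := Set.univ) (fun t _ => hσ t) (mem_Chn_univ _)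

theorem sT_mem {n : ℕ} {S : Set X} {u : SC n X} (h : u ∈ Chn n S) : sT u ∈ Chn (n + 1) S := by
  refine map_mem_of_supported _ _ (fun σ hσ => ?_) h
  rw [sT_single]
  exact push_mem (S := Set.univ) (fun t _ => hσ t) (mem_Chn_univ _)

end Subdivision

end Subdivision

section SmallSimplices

open Finsupp

section Mesh

/-- Tuples in the hull of `v` with mesh at most `d`. -/
def fineSet {n m k : ℕ} (v : Fin (k + 1) → Simp m) (d : ℝ) : Set (Fin (n + 1) → Simp m) :=
  {w | (∀ c r, (∀ i, dist (v i) c ≤ r) → ∀ i, dist (w i) c ≤ r) ∧ ∀ i j, dist (w i) (w j) ≤ d}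

theorem lsd_mem_fineSet {m : ℕ} : ∀ {n : ℕ} (v : Fin (n + 1) → Simp m) (d : ℝ),
    (∀ i j, dist (v i) (v j) ≤ d) →
    lsd m n (single v 1) ∈ supported ℚ ℚ (fineSet v (n / (n + 1) * d))
  | 0, v, d, hd => by
    refine single_mem_supported ℚ _ ⟨fun c r h => h, fun i j => ?_⟩
    have : i = j := by fin_cases i; fin_cases j; rfl
    simp [this]
  | n + 1, v, d, hd => by
    have hd0 : 0 ≤ d := (dist_nonneg).trans (hd 0 0)
    rw [lsd_single, lbd_single, map_sum, map_sum]
    refine Submodule.sum_mem _ fun i _ => ?_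
    rw [map_smul, map_smul]
    refine Submodule.smul_mem _ _ ?_
    refine map_mem_of_supported _ _ (fun w hw => ?_)
      (lsd_mem_fineSet (v ∘ i.succAbove) d fun _ _ => hd _ _)
    rw [cone_single]
    have hle : (n / (n + 1) * d : ℝ) ≤ ((n + 1 : ℕ) / ((n + 1 : ℕ) + 1) * d : ℝ) := by
      refine mul_le_mul_of_nonneg_right ?_ hd0
      rw [div_le_div_iff₀ (by positivity) (by positivity)]
      push_cast
      nlinarith
    have hb : ∀ j, dist (w j) (bary v) ≤ ((n + 1 : ℕ) / ((n + 1 : ℕ) + 1) * d : ℝ) := by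
      refine hw.1 _ _ fun j => (dist_bary_le hd _).trans (le_of_eq ?_)
      push_cast
      ring
    have h0 : (0 : ℝ) ≤ ((n + 1 : ℕ) / ((n + 1 : ℕ) + 1) * d : ℝ) := by positivity
    refine single_mem_supported ℚ _ ⟨fun c r h j => ?_, fun j k => ?_⟩
    · refine Fin.cases ?_ (fun j => ?_) j
      · exact dist_comb_le h _
      · exact hw.1 c r (fun _ => h _) j
    · refine Fin.cases ?_ (fun j => ?_) j <;> refine Fin.cases ?_ (fun k => ?_) k
      · simpa using h0
      · rw [dist_comm]; exact hb k
      · exact hb j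
      · exact (hw.2 j k).trans hle

theorem lsd_pow_mem {m n : ℕ} (N : ℕ) {v : Fin (n + 1) → Simp m} {d : ℝ}
    (hd : ∀ i j, dist (v i) (v j) ≤ d) :
    (lsd m n ^ N) (single v 1) ∈
      supported ℚ ℚ {w | ∀ i j, dist (w i) (w j) ≤ (n / (n + 1) : ℝ) ^ N * d} := by
  induction N with
  | zero => exact single_mem_supported ℚ _ (by simpa using hd)
  | succ N ih =>
    rw [pow_succ' (lsd m n), Module.End.mul_apply]
    refine map_mem_of_supported _ _ (fun w hw => ?_) ih
    refine supported_mono (fun w' hw' => ?_) (lsd_mem_fineSet w _ hw)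
    intro i j
    exact (hw'.2 i j).trans (le_of_eq (by ring))

end Mesh

variable {X Y : Type*} [TopologicalSpace X] [TopologicalSpace Y]

theorem sd_pow_push {n : ℕ} (N : ℕ) (f : C(X, Y)) (u : SC n X) :
    (sd ^ N) (push f u) = push f ((sd ^ N) u) := by
  induction N with
  | zero => rfl
  | succ N ih => simp only [pow_succ', Module.End.mul_apply, ih, sd_push]

theorem sd_pow_real {n m : ℕ} (N : ℕ) (u : LC n m) :
    (sd ^ N) (real u) = real ((lsd m n ^ N) u) := by
  induction N with
  | zero => rfl
  | succ N ih => simp only [pow_succ', Module.End.mul_apply, ih, sd_real]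

theorem bd_sd_pow {n : ℕ} (N : ℕ) (u : SC (n + 1) X) : bd ((sd ^ N) u) = (sd ^ N) (bd u) := by
  induction N with
  | zero => rfl
  | succ N ih => simp only [pow_succ', Module.End.mul_apply, bd_sd, ih]

theorem sd_pow_zero (N : ℕ) (u : SC 0 X) : (sd ^ N) u = u := by
  induction N with
  | zero => rfl
  | succ N ih => simp only [pow_succ', Module.End.mul_apply, sd_zero, ih]

theorem sd_pow_mem {n : ℕ} (N : ℕ) {S : Set X} {u : SC n X} (h : u ∈ Chn n S) :
    (sd ^ N) u ∈ Chn n S := by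
  induction N with
  | zero => exact h
  | succ N ih => simp only [pow_succ', Module.End.mul_apply]; exact sd_mem ih

/-- The homotopy from the identity to the iterated subdivision. -/
noncomputable def sTN {n : ℕ} (N : ℕ) : SC n X →ₗ[ℚ] SC (n + 1) X :=
  ∑ k ∈ Finset.range N, sT.comp (sd ^ k)

theorem sTN_apply {n : ℕ} (N : ℕ) (u : SC n X) :
    sTN N u = ∑ k ∈ Finset.range N, sT ((sd ^ k) u) := by
  simp [sTN]

theorem bd_sTN {n : ℕ} (N : ℕ) (u : SC (n + 1) X) :
    bd (sTN N u) = u - (sd ^ N) u - sTN N (bd u) := by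
  simp only [sTN_apply]
  induction N with
  | zero => simp
  | succ N ih =>
    rw [Finset.sum_range_succ, Finset.sum_range_succ, map_add, ih, bd_sT, bd_sd_pow, pow_succ',
      Module.End.mul_apply]
    abel

theorem sTN_mem {n : ℕ} (N : ℕ) {S : Set X} {u : SC n X} (h : u ∈ Chn n S) :
    sTN N u ∈ Chn (n + 1) S := by
  rw [sTN_apply]
  exact Submodule.sum_mem _ fun k _ => sT_mem (sd_pow_mem k h)

/-- Chains all of whose simplices lie in a member of the family `U`. -/
noncomputable def Sml {ι : Type*} (n : ℕ) (U : ι → Set X) : Submodule ℚ (SC n X) :=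
  supported ℚ ℚ {σ | ∃ i, ∀ t, σ t ∈ U i}

theorem Chn_le_Sml {ι : Type*} {n : ℕ} {U : ι → Set X} (i : ι) : Chn n (U i) ≤ Sml n U :=
  supported_mono fun _ hσ => ⟨i, hσ⟩

theorem sd_pow_Sml {ι : Type*} {n : ℕ} (N : ℕ) {U : ι → Set X} {u : SC n X} (h : u ∈ Sml n U) :
    (sd ^ N) u ∈ Sml n U := by
  refine map_mem_of_supported _ _ (fun σ hσ => ?_) h
  obtain ⟨i, hi⟩ := hσ
  exact Chn_le_Sml i (sd_pow_mem N (single_mem_Chn hi 1))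

theorem sTN_Sml {ι : Type*} {n : ℕ} (N : ℕ) {U : ι → Set X} {u : SC n X} (h : u ∈ Sml n U) :
    sTN N u ∈ Sml (n + 1) U := by
  refine map_mem_of_supported _ _ (fun σ hσ => ?_) h
  obtain ⟨i, hi⟩ := hσ
  exact Chn_le_Sml i (sTN_mem N (single_mem_Chn hi 1))

theorem exists_sd_single_small {ι : Type*} {n : ℕ} {U : ι → Set X} (hU : ∀ i, IsOpen (U i))
    (σ : C(Simp n, X)) (hσ : ∀ t, ∃ i, σ t ∈ U i) :
    ∃ N, (sd ^ N) (single σ 1) ∈ Sml n U := by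
  obtain ⟨δ, hδ, H⟩ := lebesgue_number_lemma_of_metric (s := (Set.univ : Set (Simp n)))
    (c := fun i => σ ⁻¹' U i) isCompact_univ (fun i => (hU i).preimage σ.continuous)
    (fun t _ => by simpa using hσ t)
  have hlt : (n / (n + 1) : ℝ) < 1 := by
    rw [div_lt_one (by positivity)]; linarith
  obtain ⟨N, hN⟩ := exists_pow_lt_of_lt_one hδ hlt
  refine ⟨N, ?_⟩
  have hd : ∀ i j : Fin (n + 1), dist (vtx i : Simp n) (vtx j) ≤ 1 := by
    intro i j
    rw [Subtype.dist_eq]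
    exact (Metric.dist_le_diam_of_mem (bounded_stdSimplex _) (vtx i).2 (vtx j).2).trans
      diam_stdSimplex_le
  rw [single_eq_push, sd_pow_push, sd_pow_real]
  refine map_mem_of_supported ((push σ).comp real) _ (fun w hw => ?_) (lsd_pow_mem N hd)
  rw [LinearMap.comp_apply, real_single, push_single]
  obtain ⟨i, hi⟩ := H (w 0) trivial
  refine single_mem_supported ℚ _ ⟨i, fun t => hi ?_⟩
  rw [Metric.mem_ball]
  refine lt_of_le_of_lt (dist_comb_le (fun j => hw j 0) t) (by simpa using hN)

theorem exists_sd_small {ι : Type*} {n : ℕ} {U : ι → Set X} (hU : ∀ i, IsOpen (U i))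
    {u : SC n X} (hu : u ∈ Chn n (⋃ i, U i)) :
    ∃ N, (sd ^ N) u ∈ Sml n U := by
  rw [Chn, supported_eq_span_single] at hu
  induction hu using Submodule.span_induction with
  | mem x hx =>
    obtain ⟨s, hs, rfl⟩ := hx
    exact exists_sd_single_small hU s fun t => by simpa using hs t
  | zero => exact ⟨0, by simp⟩
  | add x y _ _ hx hy =>
    obtain ⟨N, hN⟩ := hx
    obtain ⟨M, hM⟩ := hy
    refine ⟨N + M, ?_⟩
    rw [map_add]
    refine Submodule.add_mem _ ?_ ?_
    · rw [add_comm N M, pow_add, Module.End.mul_apply]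
      exact sd_pow_Sml _ hN
    · rw [pow_add, Module.End.mul_apply]
      exact sd_pow_Sml _ hM
  | smul c x _ hx =>
    obtain ⟨N, hN⟩ := hx
    exact ⟨N, by rw [map_smul]; exact Submodule.smul_mem _ _ hN⟩

theorem Sml_pair {n : ℕ} (A B : Set X) :
    Sml n (fun b : Bool => bif b then A else B) = Chn n A ⊔ Chn n B := by
  rw [Chn, Chn, ← supported_union, Sml]
  congr 1
  ext σ
  simp [or_comm]

/-- Splitting of a chain whose boundary is already split. -/
theorem exists_split {n : ℕ} {A B : Set X} (hA : IsOpen A) (hB : IsOpen B) {o : SC (n + 1) X}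
    (ho : o ∈ Chn (n + 1) (A ∪ B)) (hbd : bd o ∈ Chn n A ⊔ Chn n B) :
    ∃ a ∈ Chn (n + 1) A, ∃ b ∈ Chn (n + 1) B, ∃ t ∈ Chn (n + 2) (A ∪ B), o = a + b + bd t := by
  obtain ⟨N, hN⟩ := exists_sd_small (U := fun b : Bool => bif b then A else B)
    (by intro b; cases b <;> assumption) (u := o) (by rwa [← Set.union_eq_iUnion])
  rw [Sml_pair] at hN
  have hT : sTN N (bd o) ∈ Chn (n + 1) A ⊔ Chn (n + 1) B := by
    rw [← Sml_pair] at hbd ⊢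
    exact sTN_Sml N hbd
  obtain ⟨a, ha, b, hb, hab⟩ := Submodule.mem_sup.1 (Submodule.add_mem _ hN hT)
  refine ⟨a, ha, b, hb, sTN N o, sTN_mem N ho, ?_⟩
  rw [hab, bd_sTN]
  abel

end SmallSimplices

section RelativeHomology

open Finsupp

variable {X Y : Type*} [TopologicalSpace X] [TopologicalSpace Y]

/-- Chains vanishing in homology relative to the complement of `K`. -/
noncomputable def Null (n : ℕ) (K : Set X) : Submodule ℚ (SC n X) :=
  LinearMap.range (bd : SC (n + 1) X →ₗ[ℚ] SC n X) ⊔ Chn n Kᶜ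

/-- Vanishing of the homology of degree `n + 1` relative to the complement of `K`. -/
def NoRel (n : ℕ) (K : Set X) : Prop := ∀ u : SC (n + 1) X, bd u ∈ Chn n Kᶜ → u ∈ Null (n + 1) K

theorem mem_Null {n : ℕ} {K : Set X} {u : SC n X} :
    u ∈ Null n K ↔ ∃ v, ∃ o ∈ Chn n Kᶜ, u = bd v + o := by
  rw [Null, Submodule.mem_sup]
  constructor
  · rintro ⟨_, ⟨v, rfl⟩, o, ho, rfl⟩
    exact ⟨v, o, ho, rfl⟩
  · rintro ⟨v, o, ho, rfl⟩
    exact ⟨_, ⟨v, rfl⟩, o, ho, rfl⟩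

theorem bd_mem_Null {n : ℕ} {K : Set X} (v : SC (n + 1) X) : bd v ∈ Null n K :=
  Submodule.mem_sup_left ⟨v, rfl⟩

theorem mem_Null_of_Chn {n : ℕ} {K : Set X} {u : SC n X} (h : u ∈ Chn n Kᶜ) : u ∈ Null n K :=
  Submodule.mem_sup_right h

theorem Null_mono {n : ℕ} {K L : Set X} (h : K ⊆ L) : Null n L ≤ Null n K :=
  sup_le_sup_left (Chn_mono (Set.compl_subset_compl.2 h)) _

theorem bd_mem_of_mem_Null {n : ℕ} {K : Set X} {u : SC (n + 1) X} (h : u ∈ Null (n + 1) K) :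
    bd u ∈ Chn n Kᶜ := by
  obtain ⟨v, o, ho, rfl⟩ := mem_Null.1 h
  rw [map_add, bd_bd, zero_add]
  exact bd_mem ho

theorem Null_univ {n : ℕ} {u : SC n X} (h : u ∈ Null n (Set.univ : Set X)) : ∃ v, u = bd v := by
  obtain ⟨v, o, ho, rfl⟩ := mem_Null.1 h
  refine ⟨v, ?_⟩
  have : o = 0 := by
    rw [mem_Chn_iff, Set.compl_univ, Set.subset_empty_iff] at ho
    by_contra h0
    obtain ⟨σ, hσ⟩ := Finsupp.support_nonempty_iff.2 h0
    have : σ (vtx 0) ∈ carrier o := Set.mem_biUnion hσ ⟨_, rfl⟩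
    rw [ho] at this
    exact this
  rw [this, add_zero]

theorem exists_open_Null [T2Space X] {n : ℕ} {K : Set X} {u : SC n X} (h : u ∈ Null n K) :
    ∃ V, IsOpen V ∧ K ⊆ V ∧ u ∈ Null n V := by
  obtain ⟨v, o, ho, rfl⟩ := mem_Null.1 h
  refine ⟨(carrier o)ᶜ, (isCompact_carrier o).isClosed.isOpen_compl,
    Set.subset_compl_comm.1 (mem_Chn_iff.1 ho), mem_Null.2 ⟨v, o, ?_, rfl⟩⟩
  rw [mem_Chn_iff, compl_compl]

theorem exists_split_compl {n : ℕ} {K L : Set X} (hK : IsClosed K) (hL : IsClosed L)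
    {o : SC (n + 1) X} (ho : o ∈ Chn (n + 1) (K ∩ L)ᶜ) (hbd : bd o ∈ Chn n Kᶜ ⊔ Chn n Lᶜ) :
    ∃ a ∈ Chn (n + 1) Kᶜ, ∃ b ∈ Chn (n + 1) Lᶜ, ∃ t ∈ Chn (n + 2) (K ∩ L)ᶜ,
      o = a + b + bd t := by
  rw [Set.compl_inter] at *
  exact exists_split hK.isOpen_compl hL.isOpen_compl ho hbd

theorem Chn_compl_union {n : ℕ} {K L : Set X} {u : SC n X} (h : u ∈ Chn n Kᶜ)
    (h' : u ∈ Chn n Lᶜ) : u ∈ Chn n (K ∪ L)ᶜ := by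
  rw [Set.compl_union]
  exact Chn_inter h h'

theorem Null_union {n : ℕ} {K L : Set X} (hK : IsClosed K) (hL : IsClosed L)
    (hKL : NoRel n (K ∩ L)) {u : SC n X} (h : u ∈ Null n K) (h' : u ∈ Null n L) :
    u ∈ Null n (K ∪ L) := by
  obtain ⟨v, o, ho, hu⟩ := mem_Null.1 h
  obtain ⟨v', o', ho', hu'⟩ := mem_Null.1 h'
  have hs : bd (v - v') = o' - o := by
    rw [map_sub, sub_eq_sub_iff_add_eq_add, ← hu, add_comm, ← hu']
  have hsm : o' - o ∈ Chn n Kᶜ ⊔ Chn n Lᶜ :=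
    Submodule.sub_mem _ (Submodule.mem_sup_right ho') (Submodule.mem_sup_left ho)
  obtain ⟨y, c, hc, hy⟩ := mem_Null.1 (hKL (v - v') (by
    rw [hs]
    exact Submodule.sub_mem _ (Chn_mono (Set.compl_subset_compl.2 Set.inter_subset_right) ho')
      (Chn_mono (Set.compl_subset_compl.2 Set.inter_subset_left) ho)))
  have hc' : bd c = o' - o := by rw [← hs, hy, map_add, bd_bd, zero_add]
  obtain ⟨a, ha, b, hb, t, -, habt⟩ := exists_split_compl hK hL hc (by rwa [hc'])
  have hab : bd a + bd b = o' - o := by rw [← hc', habt, map_add, map_add, bd_bd, add_zero]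
  refine mem_Null.2 ⟨v - a, o + bd a, Chn_compl_union (Submodule.add_mem _ ho (bd_mem ha)) ?_, ?_⟩
  · have : o + bd a = o' - bd b := by rw [eq_sub_iff_add_eq, add_assoc, hab]; abel
    rw [this]
    exact Submodule.sub_mem _ ho' (bd_mem hb)
  · rw [hu, map_sub]; abel

theorem exists_glue {n : ℕ} {K L : Set X} (hK : IsClosed K) (hL : IsClosed L)
    {d : SC n X} {p q : SC (n + 1) X} (hpq : p - q ∈ Null (n + 1) (K ∩ L))
    (hp : bd p - d ∈ Chn n Kᶜ) (hq : bd q - d ∈ Chn n Lᶜ) :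
    ∃ u, bd u - d ∈ Chn n (K ∪ L)ᶜ ∧ u - p ∈ Null (n + 1) K ∧ u - q ∈ Null (n + 1) L := by
  obtain ⟨y, o, ho, hy⟩ := mem_Null.1 hpq
  have hbo : bd o = (bd p - d) - (bd q - d) := by
    have := congrArg bd hy
    rw [map_add, bd_bd, zero_add, map_sub] at this
    rw [← this]; abel
  obtain ⟨a, ha, b, hb, t, -, habt⟩ := exists_split_compl hK hL ho (by
    rw [hbo]
    exact Submodule.sub_mem _ (Submodule.mem_sup_left hp) (Submodule.mem_sup_right hq))
  have hab : bd a + bd b = (bd p - d) - (bd q - d) := by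
    rw [← hbo, habt, map_add, map_add, bd_bd, add_zero]
  refine ⟨p - a, Chn_compl_union ?_ ?_, ?_, ?_⟩
  · have : bd (p - a) - d = (bd p - d) - bd a := by rw [map_sub]; abel
    rw [this]
    exact Submodule.sub_mem _ hp (bd_mem ha)
  · have : bd (p - a) - d = (bd q - d) + bd b := by
      rw [map_sub, ← sub_eq_zero]
      rw [← sub_eq_zero] at hab
      rw [← neg_eq_zero, ← hab]
      abel
    rw [this]
    exact Submodule.add_mem _ hq (bd_mem hb)
  · rw [sub_sub_cancel_left]
    exact Submodule.neg_mem _ (mem_Null_of_Chn ha)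
  · have : p - a - q = bd (y + t) + b := by
      rw [sub_right_comm, hy, habt, map_add]; abel
    rw [this]
    exact Submodule.add_mem _ (bd_mem_Null _) (mem_Null_of_Chn hb)

theorem Null_of_fibers [T2Space X] {n : ℕ} {K : Set X} (hK : IsCompact K) {f : X → ℝ}
    (hf : ContinuousOn f K) (hrel : ∀ t, NoRel n (K ∩ f ⁻¹' {t})) {u : SC n X}
    (hu : ∀ t, u ∈ Null n (K ∩ f ⁻¹' {t})) : u ∈ Null n K := by
  have hcl : ∀ S : Set ℝ, IsClosed S → IsClosed (K ∩ f ⁻¹' S) := fun S hS =>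
    hf.preimage_isClosed_of_isClosed hK.isClosed hS
  obtain ⟨R, hR⟩ := (hK.image_of_continuousOn hf).isBounded.subset_closedBall 0
  have hloc : ∀ t : ℝ, ∃ W, IsOpen W ∧ t ∈ W ∧ u ∈ Null n (K ∩ f ⁻¹' W) := by
    intro t
    obtain ⟨V, hV, hKV, huV⟩ := exists_open_Null (hu t)
    have hc : IsClosed (f '' (K \ V)) :=
      ((hK.diff hV).image_of_continuousOn (hf.mono Set.sdiff_subset)).isClosed
    refine ⟨(f '' (K \ V))ᶜ, hc.isOpen_compl, ?_, Null_mono ?_ huV⟩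
    · rintro ⟨x, ⟨hxK, hxV⟩, rfl⟩
      exact hxV (hKV ⟨hxK, rfl⟩)
    · rintro x ⟨hxK, hx⟩
      by_contra hxV
      exact hx ⟨x, ⟨hxK, hxV⟩, rfl⟩
  choose W hWo hW hWn using hloc
  rcases lt_or_ge R 0 with hR0 | hR0
  · have : K = ∅ := by
      rw [Metric.closedBall_eq_empty.2 hR0, Set.subset_empty_iff, Set.image_eq_empty] at hR
      exact hR
    rw [this]
    exact mem_Null_of_Chn (by rw [Set.compl_empty]; exact mem_Chn_univ u)
  obtain ⟨t, ht0, htm, ⟨m, hm⟩, hti⟩ := exists_monotone_Icc_subset_open_cover_Icc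
    (a := -R) (b := R) (by linarith) (c := fun s => ((↑) : Set.Icc (-R) R → ℝ) ⁻¹' W s)
    (fun s => (hWo s).preimage continuous_subtype_val) (fun s _ => Set.mem_iUnion.2 ⟨s.1, hW _⟩)
  have key : ∀ k, u ∈ Null n (K ∩ f ⁻¹' Set.Icc (-R) (t k)) := by
    intro k
    induction k with
    | zero => rw [ht0, Set.Icc_self]; exact hu _
    | succ k ih =>
      have hle : (t k : ℝ) ≤ t (k + 1) := htm (Nat.le_succ k)
      obtain ⟨s, hs⟩ := hti k
      rw [← Set.Icc_union_Icc_eq_Icc (t k).2.1 hle, Set.preimage_union,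
        Set.inter_union_distrib_left]
      refine Null_union (hcl _ isClosed_Icc) (hcl _ isClosed_Icc) ?_ ih ?_
      · rw [← Set.inter_inter_distrib_left, ← Set.preimage_inter,
          Set.Icc_inter_Icc_eq_singleton (t k).2.1 hle]
        exact hrel _
      · refine Null_mono (Set.inter_subset_inter_right _ (Set.preimage_mono ?_)) (hWn s)
        intro x hx
        exact hs (a := ⟨x, (t k).2.1.trans hx.1, hx.2.trans (t (k + 1)).2.2⟩) hx
  have := key m
  rw [hm m le_rfl] at this
  rwa [Set.inter_eq_self_of_subset_left] at this
  intro x hx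
  have := hR ⟨x, hx, rfl⟩
  rwa [Real.closedBall_eq_Icc, zero_sub, zero_add] at this

end RelativeHomology

section Cones

open Finsupp Set

section Cone

variable {E : Type*} [NormedAddCommGroup E] [NormedSpace ℝ E]

theorem simp_apply_nonneg {n : ℕ} (t : Simp n) (i : Fin (n + 1)) : 0 ≤ t i := t.2.1 i

theorem smap_apply {m n : ℕ} (f : Fin (m + 1) → Fin (n + 1)) (t : Simp m) (j : Fin (n + 1)) :
    smap f t j = ∑ i with f i = j, t i := by
  change stdSimplex.map f t j = _
  simp only [stdSimplex.map_coe, FunOnFinite.linearMap_apply_apply]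

theorem smap_succAbove_apply {n : ℕ} (p : Fin (n + 2)) (t : Simp n) (k : Fin (n + 1)) :
    smap p.succAbove t (p.succAbove k) = t k := by
  rw [smap_apply, Finset.sum_eq_single k]
  · intro b hb hbk
    exact absurd (Fin.succAbove_right_injective (Finset.mem_filter.1 hb).2) hbk
  · intro h; simp at h

theorem smap_succAbove_self {n : ℕ} (p : Fin (n + 2)) (t : Simp n) :
    smap p.succAbove t p = 0 := by
  rw [smap_apply]
  refine Finset.sum_eq_zero fun i hi => ?_
  exact absurd (Finset.mem_filter.1 hi).2 (Fin.succAbove_ne p i)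

open Classical in
/-- Radial projection of a simplex onto the face opposite to the vertex `0`. -/
noncomputable def proj {n : ℕ} (t : Simp (n + 1)) : Simp n :=
  if h : 1 - t 0 = 0 then vtx 0 else
    ⟨fun i => t i.succ / (1 - t 0), fun i => div_nonneg (simp_apply_nonneg _ _)
      (sub_nonneg.2 (stdSimplex.le_one t 0)), by
      rw [← Finset.sum_div, div_eq_one_iff_eq h, eq_sub_iff_add_eq, add_comm,
        ← Fin.sum_univ_succ (fun i => t i)]
      exact t.2.2⟩

theorem proj_apply {n : ℕ} {t : Simp (n + 1)} (h : 1 - t 0 ≠ 0) (i : Fin (n + 1)) :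
    proj t i = t i.succ / (1 - t 0) := by
  rw [proj, dif_neg h]; rfl

theorem continuous_simp_apply {n : ℕ} (i : Fin (n + 1)) : Continuous fun t : Simp n => t i :=
  (continuous_apply i).comp continuous_subtype_val

theorem continuousAt_proj {n : ℕ} {t : Simp (n + 1)} (h : 1 - t 0 ≠ 0) : ContinuousAt proj t := by
  rw [Topology.IsInducing.subtypeVal.continuousAt_iff]
  have hc : Continuous fun t : Simp (n + 1) => 1 - t 0 :=
    continuous_const.sub (continuous_simp_apply 0)
  have hev : ∀ᶠ s : Simp (n + 1) in nhds t, 1 - s 0 ≠ 0 := hc.continuousAt.eventually_ne h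
  have : ContinuousAt (fun s : Simp (n + 1) => fun i : Fin (n + 1) => s i.succ / (1 - s 0)) t :=
    continuousAt_pi.2 fun i => (continuous_simp_apply _).continuousAt.div hc.continuousAt h
  refine this.congr (hev.mono fun s hs => ?_)
  funext i
  exact (proj_apply hs i).symm

/-- The cone over a singular simplex. -/
noncomputable def coneC {n : ℕ} (o : E) (σ : C(Simp n, E)) : C(Simp (n + 1), E) where
  toFun t := o + (1 - t 0) • (σ (proj t) - o)
  continuous_toFun := by
    refine continuous_const.add (continuous_iff_continuousAt.2 fun t => ?_)
    have hc : Continuous fun t : Simp (n + 1) => 1 - t 0 :=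
      continuous_const.sub (continuous_simp_apply 0)
    by_cases h : 1 - t 0 = 0
    · obtain ⟨R, hR⟩ :=
        (isCompact_range (σ.continuous.sub continuous_const)).isBounded.exists_norm_le
        (s := range fun s => σ s - o)
      have h0 : Filter.Tendsto (fun s : Simp (n + 1) => (1 - s 0) * R) (nhds t) (nhds 0) := by
        have hm : Continuous fun s : Simp (n + 1) => (1 - s 0) * R := hc.mul continuous_const
        have := hm.tendsto t
        rwa [show (1 - t 0) * R = 0 by rw [h, zero_mul]] at this
      rw [ContinuousAt, h, zero_smul]
      refine squeeze_zero_norm (fun s => ?_) h0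
      have hs := stdSimplex.le_one s 0
      rw [norm_smul, Real.norm_of_nonneg (sub_nonneg.2 hs)]
      exact mul_le_mul_of_nonneg_left (hR _ ⟨_, rfl⟩) (sub_nonneg.2 hs)
    · exact hc.continuousAt.smul
        ((σ.continuous.continuousAt.comp (continuousAt_proj h)).sub continuousAt_const)

theorem coneC_apply {n : ℕ} (o : E) (σ : C(Simp n, E)) (t : Simp (n + 1)) :
    coneC o σ t = o + (1 - t 0) • (σ (proj t) - o) := rfl

theorem face_zero_coneC {n : ℕ} (o : E) (σ : C(Simp n, E)) : face 0 (coneC o σ) = σ := by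
  ext1 t
  change coneC o σ (smap _ t) = σ t
  have h0 := smap_succAbove_self 0 t
  have hp : proj (smap (Fin.succAbove 0) t) = t := by
    ext j
    have := smap_succAbove_apply 0 t j
    rw [Fin.succAbove_zero] at this
    rw [proj_apply (by rw [h0]; norm_num), h0, Fin.succAbove_zero, this]
    simp
  rw [coneC_apply, h0, hp]
  simp

theorem face_succ_coneC {n : ℕ} (o : E) (σ : C(Simp (n + 1), E)) (i : Fin (n + 2)) :
    face i.succ (coneC o σ) = coneC o (face i σ) := by
  ext1 t
  change coneC o σ (smap _ t) = coneC o _ t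
  have h0 : smap i.succ.succAbove t 0 = t 0 := by
    simpa using smap_succAbove_apply i.succ t 0
  rw [coneC_apply, coneC_apply, h0]
  by_cases h : 1 - t 0 = 0
  · simp [h]
  congr 3
  change _ = σ (smap _ _)
  congr 1
  ext j
  rw [proj_apply (by rwa [h0]), h0]
  rcases Fin.eq_self_or_eq_succAbove i j with rfl | ⟨k, rfl⟩
  · rw [smap_succAbove_self, smap_succAbove_self, zero_div]
  · rw [smap_succAbove_apply, proj_apply h, ← Fin.succ_succAbove_succ, smap_succAbove_apply]

theorem face_one_coneC (o : E) (σ : C(Simp 0, E)) :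
    face 1 (coneC o σ) = ContinuousMap.const _ o := by
  ext1 t
  change coneC o σ (smap _ t) = o
  have h0 : smap (Fin.succAbove 1) t 0 = 1 := by
    have h1 : smap (Fin.succAbove 1) t 0 = t 0 := by simpa using smap_succAbove_apply 1 t 0
    have h2 := t.2.2
    rw [Fin.sum_univ_one] at h2
    rw [h1]; exact h2
  rw [coneC_apply, h0]
  simp

/-- The cone operator on chains. -/
noncomputable def cn {n : ℕ} (o : E) : SC n E →ₗ[ℚ] SC (n + 1) E := lmapDomain ℚ ℚ (coneC o)

theorem cn_single {n : ℕ} (o : E) (σ : C(Simp n, E)) (c : ℚ) :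
    cn o (single σ c) = single (coneC o σ) c := by simp [cn, mapDomain_single]

theorem bd_cn {n : ℕ} (o : E) (u : SC (n + 1) E) : bd (cn o u) = u - cn o (bd u) := by
  suffices H : bd.comp (cn o) = LinearMap.id - (cn (n := n) o).comp bd from DFunLike.congr_fun H u
  refine hom_ext fun v => ?_
  simp only [LinearMap.comp_apply, cn_single, bd_single, LinearMap.sub_apply,
    LinearMap.id_apply, map_sum, map_smul]
  rw [Fin.sum_univ_succ]
  simp only [Fin.val_zero, pow_zero, one_smul, Fin.val_succ, pow_succ, mul_neg, mul_one, neg_smul,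
    Finset.sum_neg_distrib, sub_eq_add_neg, face_zero_coneC, face_succ_coneC]

theorem cn_mem {n : ℕ} {o : E} {T : Set E} (hT : StarConvex ℝ o T) {u : SC n E}
    (hu : u ∈ Chn n T) : cn o u ∈ Chn (n + 1) T := by
  refine map_mem_of_supported _ _ (fun σ hσ => ?_) hu
  rw [cn_single]
  refine single_mem_Chn (fun t => ?_) _
  rw [coneC_apply]
  exact hT.add_smul_sub_mem (hσ _) (sub_nonneg.2 (stdSimplex.le_one t 0))
    (by linarith [simp_apply_nonneg t 0])

theorem exists_fill {n : ℕ} {o : E} {T : Set E} (hT : StarConvex ℝ o T) {u : SC (n + 1) E}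
    (hu : u ∈ Chn (n + 1) T) (h : bd u = 0) : ∃ w ∈ Chn (n + 2) T, bd w = u :=
  ⟨cn o u, cn_mem hT hu, by rw [bd_cn, h, map_zero, sub_zero]⟩

end Cone

section Augmentation

variable {X : Type*} [TopologicalSpace X]

open Classical in
/-- The number of points of a zero-chain in the set `U`. -/
noncomputable def aug (U : Set X) : SC 0 X →ₗ[ℚ] ℚ :=
  linearCombination ℚ fun σ => if σ (vtx 0) ∈ U then 1 else 0

theorem aug_of_mem {U : Set X} {σ : C(Simp 0, X)} (h : σ (vtx 0) ∈ U) :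
    aug U (single σ 1) = 1 := by simp [aug, h]

theorem aug_of_notMem {U : Set X} {σ : C(Simp 0, X)} (h : σ (vtx 0) ∉ U) :
    aug U (single σ 1) = 0 := by simp [aug, h]

theorem bd_single_one (σ : C(Simp 1, X)) :
    bd (single σ 1) = single (face 0 σ) 1 - single (face 1 σ) 1 := by
  rw [bd_single, Fin.sum_univ_two]
  simp [sub_eq_add_neg]

theorem aug_bd {U V : Set X} (hU : IsOpen U) (hV : IsOpen V) (hd : Disjoint U V) {u : SC 1 X}
    (hu : u ∈ Chn 1 (U ∪ V)) : aug U (bd u) = 0 := by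
  refine eq_of_supported ((aug U).comp bd) 0 (fun σ hσ => ?_) hu
  rw [LinearMap.comp_apply, bd_single_one, map_sub]
  rcases (isPreconnected_range σ.continuous).subset_or_subset hU hV hd (range_subset_iff.2 hσ)
    with h | h
  · rw [aug_of_mem (h ⟨_, rfl⟩), aug_of_mem (h ⟨_, rfl⟩)]
    simp
  · have h' : ∀ t, σ t ∉ U := fun t ht => hd.le_bot ⟨ht, h ⟨t, rfl⟩⟩
    rw [aug_of_notMem (h' _), aug_of_notMem (h' _)]
    simp

theorem aug_univ_bd (u : SC 1 X) : aug univ (bd u) = 0 :=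
  aug_bd isOpen_univ isOpen_empty disjoint_bot_right (by simpa using mem_Chn_univ u)

theorem aug_congr {U V S : Set X} (h : U ∩ S = V ∩ S) {u : SC 0 X} (hu : u ∈ Chn 0 S) :
    aug U u = aug V u := by
  refine eq_of_supported _ _ (fun σ hσ => ?_) hu
  have hs := hσ (vtx 0)
  have : σ (vtx 0) ∈ U ↔ σ (vtx 0) ∈ V :=
    ⟨fun hx => (h.le ⟨hx, hs⟩).1, fun hx => (h.ge ⟨hx, hs⟩).1⟩
  by_cases hx : σ (vtx 0) ∈ U
  · rw [aug_of_mem hx, aug_of_mem (this.1 hx)]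
  · rw [aug_of_notMem hx, aug_of_notMem (mt this.2 hx)]

theorem Chn_split {n : ℕ} {U V : Set X} (hU : IsOpen U) (hV : IsOpen V) (hd : Disjoint U V)
    {u : SC n X} (hu : u ∈ Chn n (U ∪ V)) : ∃ a ∈ Chn n U, ∃ b ∈ Chn n V, u = a + b := by
  have : Chn n (U ∪ V) ≤ Chn n U ⊔ Chn n V := by
    rw [Chn, Chn, Chn, ← supported_union]
    refine supported_mono fun σ hσ => ?_
    rcases (isPreconnected_range σ.continuous).subset_or_subset hU hV hd (range_subset_iff.2 hσ)
      with h | h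
    · exact Or.inl fun t => h ⟨t, rfl⟩
    · exact Or.inr fun t => h ⟨t, rfl⟩
  obtain ⟨a, ha, b, hb, h⟩ := Submodule.mem_sup.1 (this hu)
  exact ⟨a, ha, b, hb, h.symm⟩

theorem eq_zero_of_Chn {n : ℕ} {U V : Set X} (hd : Disjoint U V) {u : SC n X}
    (hu : u ∈ Chn n U) (hv : u ∈ Chn n V) : u = 0 := by
  have h := mem_Chn_iff.1 (Chn_inter hu hv)
  rw [hd.inter_eq, Set.subset_empty_iff] at h
  by_contra h0
  obtain ⟨σ, hσ⟩ := Finsupp.support_nonempty_iff.2 h0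
  have : σ (vtx 0) ∈ carrier u := Set.mem_biUnion hσ ⟨_, rfl⟩
  rw [h] at this
  exact this

/-- A point as a singular simplex. -/
noncomputable abbrev pt (x : X) : C(Simp 0, X) := ContinuousMap.const _ x

end Augmentation

section ConeZero

variable {E : Type*} [NormedAddCommGroup E] [NormedSpace ℝ E]

theorem bd_cn_zero (o : E) (u : SC 0 E) :
    bd (cn o u) = u - aug univ u • single (pt o) 1 := by
  suffices H : bd.comp (cn o) = LinearMap.id - (aug univ).smulRight (single (pt o) (1 : ℚ)) from
    DFunLike.congr_fun H u
  refine hom_ext fun v => ?_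
  simp only [LinearMap.comp_apply, cn_single, bd_single_one, LinearMap.sub_apply,
    LinearMap.id_apply, LinearMap.smulRight_apply, face_zero_coneC, face_one_coneC,
    aug_of_mem (mem_univ _), one_smul]

theorem exists_fill_zero {o : E} {T : Set E} (hT : StarConvex ℝ o T) {u : SC 0 E}
    (hu : u ∈ Chn 0 T) (h : aug univ u = 0) : ∃ w ∈ Chn 1 T, bd w = u :=
  ⟨cn o u, cn_mem hT hu, by rw [bd_cn_zero, h, zero_smul, sub_zero]⟩

end ConeZero

end Cones

section PlaneHomology

open Finsupp Set

section Plane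

variable {p q : ℝ × ℝ}

/-- The upper left quadrant complementary to `Ici p ∪ Iic q`. -/
def quadU (p q : ℝ × ℝ) : Set (ℝ × ℝ) := {x | x.1 < p.1 ∧ q.2 < x.2}

/-- The lower right quadrant complementary to `Ici p ∪ Iic q`. -/
def quadD (p q : ℝ × ℝ) : Set (ℝ × ℝ) := {x | q.1 < x.1 ∧ x.2 < p.2}

theorem isOpen_quadU : IsOpen (quadU p q) :=
  (isOpen_lt continuous_fst continuous_const).inter (isOpen_lt continuous_const continuous_snd)

theorem isOpen_quadD : IsOpen (quadD p q) :=
  (isOpen_lt continuous_const continuous_fst).inter (isOpen_lt continuous_snd continuous_const)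

theorem disjoint_quad (h : p ≤ q) : Disjoint (quadU p q) (quadD p q) := by
  rw [Set.disjoint_left]
  rintro x ⟨h1, -⟩ ⟨h2, -⟩
  linarith [h.1]

theorem compl_Ici_inter_compl_Iic (h : p ≤ q) :
    (Ici p)ᶜ ∩ (Iic q)ᶜ = quadU p q ∪ quadD p q := by
  ext x
  have h1 := h.1
  have h2 := h.2
  simp only [mem_inter_iff, mem_compl_iff, mem_Ici, mem_Iic, Prod.le_def, not_and_or, not_le,
    quadU, quadD, mem_union, mem_ofPred_eq]
  constructor
  · rintro ⟨h | h, h' | h'⟩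
    · linarith
    · exact Or.inl ⟨h, h'⟩
    · exact Or.inr ⟨h', h⟩
    · linarith
  · rintro (⟨h, h'⟩ | ⟨h, h'⟩)
    · exact ⟨Or.inl h, Or.inr h'⟩
    · exact ⟨Or.inr h', Or.inl h⟩

theorem quadU_starConvex : StarConvex ℝ (p.1 - 1, q.2 + 1) (quadU p q) := by
  have : Convex ℝ (quadU p q) := by
    have h1 : Convex ℝ {x : ℝ × ℝ | x.1 < p.1} :=
      convex_halfSpace_lt (LinearMap.isLinear (LinearMap.fst ℝ ℝ ℝ)) _
    have h2 : Convex ℝ {x : ℝ × ℝ | q.2 < x.2} :=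
      convex_halfSpace_gt (LinearMap.isLinear (LinearMap.snd ℝ ℝ ℝ)) _
    exact h1.inter h2
  exact this.starConvex ⟨by simp, by simp⟩

theorem quadD_starConvex : StarConvex ℝ (q.1 + 1, p.2 - 1) (quadD p q) := by
  have : Convex ℝ (quadD p q) := by
    have h1 : Convex ℝ {x : ℝ × ℝ | q.1 < x.1} :=
      convex_halfSpace_gt (LinearMap.isLinear (LinearMap.fst ℝ ℝ ℝ)) _
    have h2 : Convex ℝ {x : ℝ × ℝ | x.2 < p.2} :=
      convex_halfSpace_lt (LinearMap.isLinear (LinearMap.snd ℝ ℝ ℝ)) _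
    exact h1.inter h2
  exact this.starConvex ⟨by simp, by simp⟩

theorem starConvex_compl_Ici : StarConvex ℝ (p - (1, 1)) (Ici p)ᶜ := by
  intro x hx a b ha hb hab
  simp only [mem_compl_iff, mem_Ici, Prod.le_def, not_and_or, not_le] at hx ⊢
  simp only [Prod.fst_add, Prod.smul_fst, Prod.fst_sub, Prod.snd_add, Prod.smul_snd, Prod.snd_sub,
    smul_eq_mul]
  obtain rfl : a = 1 - b := by linarith
  rcases hx with h | h
  · left
    rcases hb.eq_or_lt with rfl | hb
    · linarith
    · nlinarith
  · right
    rcases hb.eq_or_lt with rfl | hb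
    · linarith
    · nlinarith

theorem starConvex_compl_Iic : StarConvex ℝ (q + (1, 1)) (Iic q)ᶜ := by
  intro x hx a b ha hb hab
  simp only [mem_compl_iff, mem_Iic, Prod.le_def, not_and_or, not_le] at hx ⊢
  simp only [Prod.fst_add, Prod.smul_fst, Prod.snd_add, Prod.smul_snd, smul_eq_mul]
  obtain rfl : a = 1 - b := by linarith
  rcases hx with h | h
  · left
    rcases hb.eq_or_lt with rfl | hb
    · linarith
    · nlinarith
  · right
    rcases hb.eq_or_lt with rfl | hb
    · linarith
    · nlinarith

theorem exists_fill_quad (h : p ≤ q) {n : ℕ} {u : SC (n + 1) (ℝ × ℝ)}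
    (hu : u ∈ Chn (n + 1) ((Ici p)ᶜ ∩ (Iic q)ᶜ)) (hb : bd u = 0) :
    ∃ w ∈ Chn (n + 2) ((Ici p)ᶜ ∩ (Iic q)ᶜ), bd w = u := by
  rw [compl_Ici_inter_compl_Iic h] at *
  obtain ⟨a, ha, b, hb', rfl⟩ := Chn_split isOpen_quadU isOpen_quadD (disjoint_quad h) hu
  have hab : bd a = - bd b := by rw [← add_eq_zero_iff_eq_neg, ← map_add, hb]
  have ha0 : bd a = 0 := eq_zero_of_Chn (disjoint_quad h) (bd_mem ha)
    (by rw [hab]; exact Submodule.neg_mem _ (bd_mem hb'))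
  have hb0 : bd b = 0 := by rw [← neg_eq_zero, ← hab, ha0]
  obtain ⟨w, hw, rfl⟩ := exists_fill quadU_starConvex ha ha0
  obtain ⟨w', hw', rfl⟩ := exists_fill quadD_starConvex hb' hb0
  exact ⟨w + w', Submodule.add_mem _ (Chn_mono subset_union_left hw)
    (Chn_mono subset_union_right hw'), map_add _ _ _⟩

/-- The half plane above the diagonal through `r`. -/
def diagU (r : ℝ × ℝ) : Set (ℝ × ℝ) := {x | r.2 - r.1 < x.2 - x.1}

theorem diagU_inter {r : ℝ × ℝ} (hr : r ∈ Icc p q) :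
    diagU r ∩ (quadU p q ∪ quadD p q) = quadU p q ∩ (quadU p q ∪ quadD p q) := by
  obtain ⟨⟨h1, h2⟩, h3, h4⟩ := hr
  ext x
  simp only [mem_inter_iff, diagU, quadU, quadD, mem_union, mem_ofPred_eq]
  constructor
  · rintro ⟨h, h' | h'⟩
    · exact ⟨h', Or.inl h'⟩
    · linarith
  · rintro ⟨h, -⟩
    exact ⟨by linarith, Or.inl h⟩

theorem exists_fill_quad_zero {r : ℝ × ℝ} (hr : r ∈ Icc p q) {u : SC 0 (ℝ × ℝ)}
    (hu : u ∈ Chn 0 ((Ici p)ᶜ ∩ (Iic q)ᶜ)) (h0 : aug univ u = 0) (h1 : aug (diagU r) u = 0) :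
    ∃ w ∈ Chn 1 ((Ici p)ᶜ ∩ (Iic q)ᶜ), bd w = u := by
  have h : p ≤ q := hr.1.trans hr.2
  rw [compl_Ici_inter_compl_Iic h] at *
  rw [aug_congr (diagU_inter hr) hu] at h1
  obtain ⟨a, ha, b, hb', rfl⟩ := Chn_split isOpen_quadU isOpen_quadD (disjoint_quad h) hu
  have hbU : aug (quadU p q) b = 0 := by
    rw [aug_congr (V := ∅) (by rw [(disjoint_quad h).inter_eq, empty_inter]) hb']
    rw [aug_congr (V := ∅) (S := univ) rfl (mem_Chn_univ _)]
    suffices H : aug (∅ : Set (ℝ × ℝ)) = 0 by rw [H]; rfl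
    exact hom_ext fun σ => by rw [aug_of_notMem (by simp)]; rfl
  have ha0 : aug univ a = 0 := by
    rw [aug_congr (V := quadU p q) (by simp) ha]
    rwa [map_add, hbU, add_zero] at h1
  have hb0 : aug univ b = 0 := by rwa [map_add, ha0, zero_add] at h0
  obtain ⟨w, hw, rfl⟩ := exists_fill_zero quadU_starConvex ha ha0
  obtain ⟨w', hw', rfl⟩ := exists_fill_zero quadD_starConvex hb' hb0
  exact ⟨w + w', Submodule.add_mem _ (Chn_mono subset_union_left hw)
    (Chn_mono subset_union_right hw'), map_add _ _ _⟩

theorem Null_of_split {n : ℕ} {u t : SC (n + 2) (ℝ × ℝ)} {a b : SC (n + 1) (ℝ × ℝ)}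
    (ha : a ∈ Chn (n + 1) (Ici p)ᶜ) (hb : b ∈ Chn (n + 1) (Iic q)ᶜ)
    (ht : t ∈ Chn (n + 2) (Icc p q)ᶜ) (hu : bd u = a + b + bd t)
    (hs : ∃ s ∈ Chn (n + 1) ((Ici p)ᶜ ∩ (Iic q)ᶜ), bd s = bd a) : u ∈ Null (n + 2) (Icc p q) := by
  obtain ⟨s, hs, hsa⟩ := hs
  have hab : bd a + bd b = 0 := by
    have := congrArg bd hu
    rw [bd_bd, map_add, map_add, bd_bd, add_zero] at this
    exact this.symm
  obtain ⟨a', ha', h1⟩ := exists_fill starConvex_compl_Ici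
    (Submodule.sub_mem _ ha (Chn_mono inter_subset_left hs)) (by rw [map_sub, hsa, sub_self])
  obtain ⟨b', hb', h2⟩ := exists_fill starConvex_compl_Iic
    (Submodule.add_mem _ hb (Chn_mono inter_subset_right hs))
    (by rw [map_add, hsa, add_comm, hab])
  obtain ⟨w, -, hw⟩ := exists_fill (starConvex_univ (0 : ℝ × ℝ)) (mem_Chn_univ (u - (a' + b' + t)))
    (by rw [map_sub, map_add, map_add, h1, h2, hu]; abel)
  refine mem_Null.2 ⟨w, a' + b' + t, ?_, by rw [hw]; abel⟩
  refine Submodule.add_mem _ (Submodule.add_mem _ (Chn_mono ?_ ha') (Chn_mono ?_ hb')) ht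
  · exact compl_subset_compl.2 fun x hx => hx.1
  · exact compl_subset_compl.2 fun x hx => hx.2

theorem exists_split_Icc {n : ℕ} {o : SC (n + 1) (ℝ × ℝ)} (ho : o ∈ Chn (n + 1) (Icc p q)ᶜ)
    (hbd : bd o ∈ Chn n (Ici p)ᶜ ⊔ Chn n (Iic q)ᶜ) :
    ∃ a ∈ Chn (n + 1) (Ici p)ᶜ, ∃ b ∈ Chn (n + 1) (Iic q)ᶜ, ∃ t ∈ Chn (n + 2) (Icc p q)ᶜ,
      o = a + b + bd t :=
  exists_split_compl isClosed_Ici isClosed_Iic ho hbd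

theorem bd_mem_quad {n : ℕ} {o : SC (n + 2) (ℝ × ℝ)} {a b : SC (n + 1) (ℝ × ℝ)}
    {t : SC (n + 2) (ℝ × ℝ)}
    (ha : a ∈ Chn (n + 1) (Ici p)ᶜ) (hb : b ∈ Chn (n + 1) (Iic q)ᶜ)
    (h : bd o = a + b + bd t) : bd a ∈ Chn n ((Ici p)ᶜ ∩ (Iic q)ᶜ) := by
  refine Chn_inter (bd_mem ha) ?_
  have := congrArg bd h
  rw [bd_bd, map_add, map_add, bd_bd, add_zero] at this
  rw [eq_neg_of_add_eq_zero_left this.symm]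
  exact Submodule.neg_mem _ (bd_mem hb)

theorem NoRel_Icc (h : p ≤ q) (n : ℕ) : NoRel (n + 2) (Icc p q) := by
  intro u hu
  obtain ⟨a, ha, b, hb, t, ht, hab⟩ := exists_split_Icc hu
    (by rw [bd_bd]; exact Submodule.zero_mem _)
  exact Null_of_split ha hb ht hab
    (exists_fill_quad h (bd_mem_quad ha hb hab) (bd_bd _))

theorem Null_Icc_of_aug {r : ℝ × ℝ} (hr : r ∈ Icc p q) {u t : SC 2 (ℝ × ℝ)} {a b : SC 1 (ℝ × ℝ)}
    (ha : a ∈ Chn 1 (Ici p)ᶜ) (hb : b ∈ Chn 1 (Iic q)ᶜ)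
    (ht : t ∈ Chn 2 (Icc p q)ᶜ) (hu : bd u = a + b + bd t)
    (h0 : aug (diagU r) (bd a) = 0) : u ∈ Null 2 (Icc p q) :=
  Null_of_split ha hb ht hu
    (exists_fill_quad_zero hr (bd_mem_quad ha hb hu) (aug_univ_bd a) h0)

theorem Null_Icc_of_point {r : ℝ × ℝ} (hr : r ∈ Icc p q) {u : SC 2 (ℝ × ℝ)}
    (hu : bd u ∈ Chn 1 (Icc p q)ᶜ) (h : u ∈ Null 2 {r}) : u ∈ Null 2 (Icc p q) := by
  obtain ⟨a, ha, b, hb, t, ht, hab⟩ := exists_split_Icc hu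
    (by rw [bd_bd]; exact Submodule.zero_mem _)
  refine Null_Icc_of_aug hr ha hb ht hab ?_
  obtain ⟨v, o, ho, hv⟩ := mem_Null.1 h
  have hrr : ({r} : Set (ℝ × ℝ)) = Icc r r := (Icc_self r).symm
  have ha' : a ∈ Chn 1 (Ici r)ᶜ := Chn_mono (compl_subset_compl.2 (Ici_subset_Ici.2 hr.1)) ha
  have hb' : b ∈ Chn 1 (Iic r)ᶜ := Chn_mono (compl_subset_compl.2 (Iic_subset_Iic.2 hr.2)) hb
  have hbo : bd (o - t) = a + b := by
    have := congrArg bd hv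
    rw [map_add, bd_bd, zero_add, hab] at this
    rw [map_sub, ← this]; abel
  rw [hrr] at ho
  obtain ⟨a2, ha2, b2, hb2, t2, -, hab2⟩ := exists_split_Icc (o := o - t)
    (Submodule.sub_mem _ ho (Chn_mono (compl_subset_compl.2 (Icc_subset_Icc hr.1 hr.2)) ht))
    (by rw [hbo]; exact Submodule.add_mem _ (Submodule.mem_sup_left ha')
          (Submodule.mem_sup_right hb'))
  have hs : a - bd a2 = -(b - bd b2) := by
    have := congrArg bd hab2
    rw [hbo, map_add, map_add, bd_bd, add_zero] at this
    rw [← sub_eq_zero] at this ⊢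
    rw [← this]; abel
  have hq : a - bd a2 ∈ Chn 1 (quadU r r ∪ quadD r r) := by
    rw [← compl_Ici_inter_compl_Iic le_rfl]
    refine Chn_inter (Submodule.sub_mem _ ha' (bd_mem ha2)) ?_
    rw [hs]
    exact Submodule.neg_mem _ (Submodule.sub_mem _ hb' (bd_mem hb2))
  have h0 := aug_bd isOpen_quadU isOpen_quadD (disjoint_quad le_rfl) hq
  rw [← aug_congr (diagU_inter ⟨le_rfl, le_rfl⟩) (bd_mem hq), map_sub, bd_bd, sub_zero] at h0
  exact h0

theorem exists_comb_Null_Icc (h : p ≤ q) {u v : SC 2 (ℝ × ℝ)} (hu : bd u ∈ Chn 1 (Icc p q)ᶜ)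
    (hv : bd v ∈ Chn 1 (Icc p q)ᶜ) :
    ∃ s t : ℚ, (s ≠ 0 ∨ t ≠ 0) ∧ s • u + t • v ∈ Null 2 (Icc p q) := by
  obtain ⟨a, ha, b, hb, y, hy, hab⟩ := exists_split_Icc hu
    (by rw [bd_bd]; exact Submodule.zero_mem _)
  obtain ⟨a', ha', b', hb', y', hy', hab'⟩ := exists_split_Icc hv
    (by rw [bd_bd]; exact Submodule.zero_mem _)
  have key : ∀ s t : ℚ, s * aug (diagU p) (bd a) + t * aug (diagU p) (bd a') = 0 →
      s • u + t • v ∈ Null 2 (Icc p q) := by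
    intro s t hst
    refine Null_Icc_of_aug (r := p) ⟨le_rfl, h⟩ (a := s • a + t • a') (b := s • b + t • b')
      (t := s • y + t • y') ?_ ?_ ?_ ?_ ?_
    · exact Submodule.add_mem _ (Submodule.smul_mem _ _ ha) (Submodule.smul_mem _ _ ha')
    · exact Submodule.add_mem _ (Submodule.smul_mem _ _ hb) (Submodule.smul_mem _ _ hb')
    · exact Submodule.add_mem _ (Submodule.smul_mem _ _ hy) (Submodule.smul_mem _ _ hy')
    · simp only [map_add, map_smul, hab, hab']
      module
    · simpa only [map_add, map_smul, smul_eq_mul] using hst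
  by_cases h0 : aug (diagU p) (bd a) = 0
  · exact ⟨1, 0, by simp, key 1 0 (by simp [h0])⟩
  · exact ⟨-aug (diagU p) (bd a'), aug (diagU p) (bd a), Or.inr h0, key _ _ (by ring)⟩

theorem Null_one_Icc {u : SC 1 (ℝ × ℝ)} (hu : bd u ∈ Chn 0 (Icc p q)ᶜ) :
    u ∈ Null 1 (Icc p q) := by
  have hopen : ∀ c : Bool, IsOpen (bif c then (Ici p)ᶜ else (Iic q)ᶜ) := by
    intro c
    cases c
    · exact isClosed_Iic.isOpen_compl
    · exact isClosed_Ici.isOpen_compl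
  have hcov : (Icc p q)ᶜ = ⋃ c : Bool, (bif c then (Ici p)ᶜ else (Iic q)ᶜ) := by
    rw [← Set.union_eq_iUnion, ← compl_inter]; rfl
  obtain ⟨N, hN⟩ := exists_sd_small hopen (by rwa [← hcov])
  rw [sd_pow_zero, Sml_pair] at hN
  obtain ⟨a, ha, b, hb, hab⟩ := Submodule.mem_sup.1 hN
  let x : ℝ × ℝ := (p.1 - 1, q.2 + 1)
  have hxA : x ∈ (Ici p)ᶜ := fun hx => by
    have : p.1 ≤ p.1 - 1 := hx.1
    linarith
  have hxB : x ∈ (Iic q)ᶜ := fun hx => by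
    have : q.2 + 1 ≤ q.2 := hx.2
    linarith
  have hpt : aug univ (single (pt x) 1) = 1 := aug_of_mem (mem_univ _)
  have hsum : aug univ a + aug univ b = 0 := by rw [← map_add, hab, aug_univ_bd]
  obtain ⟨a', ha', h1⟩ := exists_fill_zero (u := a - aug univ a • single (pt x) 1)
    starConvex_compl_Ici
    (Submodule.sub_mem _ ha (Submodule.smul_mem _ _ (single_mem_Chn (fun _ => hxA) _)))
    (by rw [map_sub, map_smul, hpt]; simp)
  obtain ⟨b', hb', h2⟩ := exists_fill_zero (u := b - aug univ b • single (pt x) 1)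
    starConvex_compl_Iic
    (Submodule.sub_mem _ hb (Submodule.smul_mem _ _ (single_mem_Chn (fun _ => hxB) _)))
    (by rw [map_sub, map_smul, hpt]; simp)
  obtain ⟨w, -, hw⟩ := exists_fill (starConvex_univ (0 : ℝ × ℝ)) (mem_Chn_univ (u - (a' + b')))
    (by
      rw [map_sub, map_add, h1, h2, ← hab, eq_neg_of_add_eq_zero_left hsum]
      module)
  refine mem_Null.2 ⟨w, a' + b', ?_, by rw [hw]; abel⟩
  refine Submodule.add_mem _ (Chn_mono ?_ ha') (Chn_mono ?_ hb')
  · exact compl_subset_compl.2 fun x hx => hx.1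
  · exact compl_subset_compl.2 fun x hx => hx.2

end Plane

end PlaneHomology

section Excision

open Finsupp Set Topology

section Excision

variable {X Y : Type*} [TopologicalSpace X] [TopologicalSpace Y]

theorem exists_push {φ : C(Y, X)} (hφ : IsOpenEmbedding φ) {n : ℕ} {S : Set X}
    {u : SC n X} (hu : u ∈ Chn n (range φ ∩ S)) : ∃ u' ∈ Chn n (φ ⁻¹' S), push φ u' = u := by
  suffices H : u ∈ (Chn n (φ ⁻¹' S)).map (push φ) from H
  refine map_mem_of_supported LinearMap.id _ (fun σ hσ => ?_) hu
  let τ : C(Simp n, Y) := ⟨fun t => (hφ.isEmbedding.toHomeomorph.symm ⟨σ t, (hσ t).1⟩), by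
    refine (Homeomorph.continuous _).comp ?_
    exact σ.continuous.subtype_mk _⟩
  have hτ : φ.comp τ = σ := by
    ext1 t
    exact congrArg Subtype.val
      (hφ.isEmbedding.toHomeomorph.apply_symm_apply ⟨σ t, (hσ t).1⟩)
  refine ⟨single τ 1, single_mem_Chn (fun t => ?_) 1, by rw [push_single, hτ]; rfl⟩
  have := (hσ t).2
  rw [← hτ] at this
  exact this

theorem push_injective {φ : C(Y, X)} (hφ : IsOpenEmbedding φ) (n : ℕ) :
    Function.Injective (push (n := n) φ) :=
  Finsupp.mapDomain_injective fun σ τ h => by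
    ext1 t
    exact hφ.injective (DFunLike.congr_fun h t)

theorem mem_Chn_of_push_mem {φ : C(Y, X)} (hφ : IsOpenEmbedding φ) {n : ℕ} {S : Set X}
    {u : SC n Y} (hu : push φ u ∈ Chn n S) : u ∈ Chn n (φ ⁻¹' S) := by
  obtain ⟨u', h, h'⟩ := exists_push hφ (S := S) (u := push φ u)
    (Chn_inter (push_mem (fun x _ => mem_range_self x) (mem_Chn_univ u)) hu)
  rwa [← push_injective hφ n h']

theorem sub_sd_mem_Null {n : ℕ} {K : Set X} {u : SC (n + 1) X} (hu : bd u ∈ Chn n Kᶜ) (N : ℕ) :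
    u - (sd ^ N) u ∈ Null (n + 1) K :=
  mem_Null.2 ⟨sTN N u, sTN N (bd u), sTN_mem N hu, by rw [bd_sTN]; abel⟩

variable {φ : C(Y, X)} {K : Set Y}

theorem preimage_compl_image (hφ : IsOpenEmbedding φ) : φ ⁻¹' (φ '' K)ᶜ = Kᶜ := by
  rw [preimage_compl, hφ.injective.preimage_image]

theorem push_mem_compl (hφ : IsOpenEmbedding φ) {n : ℕ} {u : SC n Y} (hu : u ∈ Chn n Kᶜ) :
    push φ u ∈ Chn n (φ '' K)ᶜ :=
  push_mem (S := Kᶜ) (T := (φ '' K)ᶜ) (f := φ)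
    (fun _ hx h => hx (hφ.injective.mem_set_image.1 h)) hu

theorem push_mem_Null (hφ : IsOpenEmbedding φ) {n : ℕ} {u : SC n Y} (hu : u ∈ Null n K) :
    push φ u ∈ Null n (φ '' K) := by
  obtain ⟨v, o, ho, rfl⟩ := mem_Null.1 hu
  exact mem_Null.2 ⟨push φ v, push φ o, push_mem_compl hφ ho, by rw [map_add, bd_push]⟩

theorem range_union_compl_image : range φ ∪ (φ '' K)ᶜ = univ := by
  rw [← univ_subset_iff, ← union_compl_self (φ '' K)]
  exact union_subset_union_left _ (image_subset_range _ _)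

theorem exists_sd_split (hφ : IsOpenEmbedding φ) (hK : IsClosed (φ '' K)) {n : ℕ} (u : SC n X) :
    ∃ N, ∃ a : SC n Y, ∃ b ∈ Chn n (φ '' K)ᶜ, (sd ^ N) u = push φ a + b := by
  obtain ⟨N, hN⟩ := exists_sd_small (n := n) (u := u)
    (U := fun b : Bool => bif b then range φ else (φ '' K)ᶜ)
    (by
      intro b
      cases b
      · exact hK.isOpen_compl
      · exact hφ.isOpen_range)
    (by
      rw [← Set.union_eq_iUnion, range_union_compl_image]
      exact mem_Chn_univ u)
  rw [Sml_pair] at hN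
  obtain ⟨a, ha, b, hb, hab⟩ := Submodule.mem_sup.1 hN
  obtain ⟨a', -, rfl⟩ := exists_push hφ (S := univ) (by rwa [inter_univ])
  exact ⟨N, a', b, hb, hab.symm⟩

theorem exists_excise (hφ : IsOpenEmbedding φ) (hK : IsClosed (φ '' K)) {n : ℕ}
    {u : SC (n + 1) X} (hu : bd u ∈ Chn n (φ '' K)ᶜ) :
    ∃ u', bd u' ∈ Chn n Kᶜ ∧ u - push φ u' ∈ Null (n + 1) (φ '' K) := by
  obtain ⟨N, a, b, hb, hab⟩ := exists_sd_split hφ hK u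
  refine ⟨a, ?_, ?_⟩
  · rw [← preimage_compl_image hφ]
    refine mem_Chn_of_push_mem hφ ?_
    rw [← bd_push, eq_sub_of_add_eq hab.symm, map_sub, bd_sd_pow]
    exact Submodule.sub_mem _ (sd_pow_mem N hu) (bd_mem hb)
  · have : u - push φ a = (u - (sd ^ N) u) + b := by rw [hab]; abel
    rw [this]
    exact Submodule.add_mem _ (sub_sd_mem_Null hu N) (mem_Null_of_Chn hb)

theorem mem_Null_of_push (hφ : IsOpenEmbedding φ) (hK : IsClosed (φ '' K)) {n : ℕ}
    {u : SC (n + 1) Y} (hu : push φ u ∈ Null (n + 1) (φ '' K)) : u ∈ Null (n + 1) K := by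
  have hbu : bd u ∈ Chn n Kᶜ := by
    rw [← preimage_compl_image hφ]
    refine mem_Chn_of_push_mem hφ ?_
    rw [← bd_push]
    exact bd_mem_of_mem_Null hu
  obtain ⟨v, o, ho, h⟩ := mem_Null.1 hu
  obtain ⟨N, a, b, hb, hab⟩ := exists_sd_split hφ hK v
  have hs : (sd ^ N) u - bd a ∈ Chn (n + 1) Kᶜ := by
    rw [← preimage_compl_image hφ]
    refine mem_Chn_of_push_mem hφ ?_
    have : push φ ((sd ^ N) u - bd a) = bd b + (sd ^ N) o := by
      rw [map_sub, ← sd_pow_push, h, map_add, ← bd_sd_pow, hab, ← bd_push, map_add]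
      abel
    rw [this]
    exact Submodule.add_mem _ (bd_mem hb) (sd_pow_mem N ho)
  have : u = (u - (sd ^ N) u) + (bd a + ((sd ^ N) u - bd a)) := by abel
  rw [this]
  exact Submodule.add_mem _ (sub_sd_mem_Null hbu N)
    (Submodule.add_mem _ (bd_mem_Null a) (mem_Null_of_Chn hs))

theorem NoRel_image (hφ : IsOpenEmbedding φ) (hK : IsClosed (φ '' K)) {n : ℕ} (h : NoRel n K) :
    NoRel n (φ '' K) := by
  intro u hu
  obtain ⟨u', h1, h2⟩ := exists_excise hφ hK hu
  simpa using Submodule.add_mem _ h2 (push_mem_Null hφ (h u' h1))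

end Excision

section PlaneCompact

theorem NoRel_empty {X : Type*} [TopologicalSpace X] (n : ℕ) : NoRel n (∅ : Set X) :=
  fun u _ => mem_Null_of_Chn (by rw [compl_empty]; exact mem_Chn_univ u)

theorem NoRel_singleton (n : ℕ) (r : ℝ × ℝ) : NoRel (n + 2) {r} := by
  rw [← Icc_self]; exact NoRel_Icc le_rfl n

theorem fiber_fiber (K : Set (ℝ × ℝ)) (t s : ℝ) :
    (K ∩ Prod.fst ⁻¹' {t}) ∩ Prod.snd ⁻¹' {s} = ∅ ∨
      (t, s) ∈ K ∧ (K ∩ Prod.fst ⁻¹' {t}) ∩ Prod.snd ⁻¹' {s} = {(t, s)} := by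
  by_cases h : (t, s) ∈ K
  · right
    refine ⟨h, Subset.antisymm ?_ ?_⟩
    · rintro ⟨x, y⟩ ⟨⟨-, h1⟩, h2⟩
      exact Prod.ext h1 h2
    · rintro _ rfl
      exact ⟨⟨h, rfl⟩, rfl⟩
  · left
    rw [eq_empty_iff_forall_notMem]
    rintro ⟨x, y⟩ ⟨⟨hK, h1⟩, h2⟩
    obtain rfl : x = t := h1
    obtain rfl : y = s := h2
    exact h hK

theorem Null_of_points_aux {n : ℕ} {K : Set (ℝ × ℝ)} (hK : IsCompact K)
    (hn : ∀ t, NoRel n (K ∩ Prod.fst ⁻¹' {t})) (hn' : ∀ r, NoRel n ({r} : Set (ℝ × ℝ)))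
    {u : SC n (ℝ × ℝ)} (hu : ∀ r ∈ K, u ∈ Null n {r}) : u ∈ Null n K := by
  refine Null_of_fibers hK continuous_fst.continuousOn hn fun t => ?_
  refine Null_of_fibers (hK.inter_right (isClosed_singleton.preimage continuous_fst))
    continuous_snd.continuousOn (fun s => ?_) (fun s => ?_)
  · rcases fiber_fiber K t s with h | ⟨-, h⟩
    · rw [h]; exact NoRel_empty _
    · rw [h]; exact hn' _
  · rcases fiber_fiber K t s with h | ⟨h', h⟩
    · rw [h]; exact mem_Null_of_Chn (by rw [compl_empty]; exact mem_Chn_univ u)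
    · rw [h]; exact hu _ h'

theorem NoRel_column (n : ℕ) {K : Set (ℝ × ℝ)} (hK : IsCompact K) (t : ℝ) :
    NoRel (n + 2) (K ∩ Prod.fst ⁻¹' {t}) := by
  intro u hu
  refine Null_of_fibers (hK.inter_right (isClosed_singleton.preimage continuous_fst))
    continuous_snd.continuousOn (fun s => ?_) (fun s => ?_)
  · rcases fiber_fiber K t s with h | ⟨-, h⟩
    · rw [h]; exact NoRel_empty _
    · rw [h]; exact NoRel_singleton (n + 1) _
  · rcases fiber_fiber K t s with h | ⟨h', h⟩
    · rw [h]; exact mem_Null_of_Chn (by rw [compl_empty]; exact mem_Chn_univ u)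
    · rw [h]
      refine NoRel_singleton n _ u (Chn_mono (compl_subset_compl.2 ?_) hu)
      rw [← h]; exact inter_subset_left

theorem NoRel_of_isCompact (n : ℕ) {K : Set (ℝ × ℝ)} (hK : IsCompact K) : NoRel (n + 2) K := by
  intro u hu
  refine Null_of_points_aux hK (fun t => NoRel_column (n + 1) hK t)
    (fun r => NoRel_singleton (n + 1) r) fun r hr => ?_
  exact NoRel_singleton n r u (Chn_mono (compl_subset_compl.2 (singleton_subset_iff.2 hr)) hu)

theorem Null_of_points_plane {K : Set (ℝ × ℝ)} (hK : IsCompact K) {u : SC 2 (ℝ × ℝ)}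
    (hu : ∀ r ∈ K, u ∈ Null 2 {r}) : u ∈ Null 2 K :=
  Null_of_points_aux hK (fun t => NoRel_column 0 hK t) (fun r => NoRel_singleton 0 r) hu

end PlaneCompact

section Surface

variable {M : Type*} [TopologicalSpace M]

/-- The space is covered by open copies of the plane. -/
def PlaneCovered (M : Type*) [TopologicalSpace M] : Prop :=
  ∀ x : M, ∃ φ : C(ℝ × ℝ, M), IsOpenEmbedding φ ∧ φ 0 = x

theorem planeCovered_of_chartedSpace [ChartedSpace (EuclideanSpace ℝ (Fin 2)) M] :
    PlaneCovered M := by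
  intro x
  let e := chartAt (EuclideanSpace ℝ (Fin 2)) x
  obtain ⟨r, hr, hb⟩ := Metric.isOpen_iff.1 e.open_target (e x) (mem_chart_target _ x)
  let b := OpenPartialHomeomorph.univBall (e x) r
  have hbt : b.target = Metric.ball (e x) r := OpenPartialHomeomorph.univBall_target _ hr
  have hbs : b.source = univ := OpenPartialHomeomorph.univBall_source _ _
  let f := b.trans e.symm
  have hf : f.source = univ := by
    rw [OpenPartialHomeomorph.trans_source, hbs, univ_inter, eq_univ_iff_forall]
    intro y
    refine hb ?_
    rw [← hbt]
    exact b.map_source (by rw [hbs]; trivial)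
  let h : (ℝ × ℝ) ≃ₜ EuclideanSpace ℝ (Fin 2) :=
    (Homeomorph.finTwoArrow (X := ℝ)).symm.trans (EuclideanSpace.equiv (Fin 2) ℝ).toHomeomorph.symm
  have he : IsOpenEmbedding (f ∘ h) := (f.isOpenEmbedding hf).comp h.isOpenEmbedding
  refine ⟨⟨f ∘ h, he.continuous⟩, he, ?_⟩
  have h0 : h 0 = 0 := by
    ext i
    fin_cases i <;> rfl
  have hb0 : b 0 = e x := OpenPartialHomeomorph.univBall_apply_zero _ _
  change e.symm (b (h 0)) = x
  rw [h0, hb0]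
  exact e.left_inv (mem_chart_source _ x)

theorem mem_Chn_compl_of_points {n : ℕ} {K : Set M} {u : SC n M}
    (h : ∀ x ∈ K, u ∈ Chn n {x}ᶜ) : u ∈ Chn n Kᶜ :=
  fun _ hσ t ht => h _ ht hσ t rfl

variable [T2Space M]

theorem isClosed_image {φ : C(ℝ × ℝ, M)} {K : Set (ℝ × ℝ)} (hK : IsCompact K) :
    IsClosed (φ '' K) := (hK.image φ.continuous).isClosed

theorem NoRel_of_subset_range (n : ℕ) {φ : C(ℝ × ℝ, M)} (hφ : IsOpenEmbedding φ) {K : Set M}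
    (hK : IsCompact K) (h : K ⊆ range φ) : NoRel (n + 2) K := by
  have hc : IsCompact (φ ⁻¹' K) := hφ.isInducing.isCompact_preimage' hK h
  rw [← image_preimage_eq_of_subset h]
  exact NoRel_image hφ (isClosed_image hc) (NoRel_of_isCompact n hc)

theorem Null_of_points_of_subset_range {φ : C(ℝ × ℝ, M)} (hφ : IsOpenEmbedding φ) {K : Set M}
    (hK : IsCompact K) (h : K ⊆ range φ) {u : SC 2 M} (hu : ∀ x ∈ K, u ∈ Null 2 {x}) :
    u ∈ Null 2 K := by
  have hc : IsCompact (φ ⁻¹' K) := hφ.isInducing.isCompact_preimage' hK h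
  have hK' := image_preimage_eq_of_subset h
  obtain ⟨u', h1, h2⟩ := exists_excise (K := φ ⁻¹' K) (n := 1) (u := u) hφ (isClosed_image hc) (by
    rw [hK']
    exact mem_Chn_compl_of_points fun x hx => bd_mem_of_mem_Null (hu x hx))
  have h3 : u' ∈ Null 2 (φ ⁻¹' K) := by
    refine Null_of_points_plane hc fun r hr => ?_
    refine mem_Null_of_push hφ (isClosed_image isCompact_singleton) ?_
    have := Submodule.sub_mem _ (hu _ hr)
      (Null_mono (L := φ '' (φ ⁻¹' K)) (by rw [hK', singleton_subset_iff]; exact hr) h2)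
    rw [image_singleton]
    simpa using this
  have := Submodule.add_mem _ h2 (push_mem_Null hφ h3)
  rwa [hK', sub_add_cancel] at this

theorem Null_of_points (hM : PlaneCovered M) {K : Set M} (hK : IsCompact K) {u : SC 2 M}
    (hu : ∀ x ∈ K, u ∈ Null 2 {x}) : u ∈ Null 2 K := by
  classical
  choose φ hφ hφ0 using hM
  obtain ⟨t, ht⟩ := hK.elim_finite_subcover (fun x => range (φ x)) (fun x => (hφ x).isOpen_range)
    fun x _ => mem_iUnion.2 ⟨x, 0, hφ0 x⟩
  obtain ⟨L, hL, hLs, rfl⟩ := hK.finite_compact_cover t (fun x => range (φ x))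
    (fun x _ => (hφ x).isOpen_range) ht
  clear ht hK
  induction t using Finset.induction_on with
  | empty => simpa using mem_Null_of_Chn (K := ∅) (by rw [compl_empty]; exact mem_Chn_univ u)
  | insert a s ha ih =>
    rw [Finset.set_biUnion_insert] at hu ⊢
    have hs : IsCompact (⋃ i ∈ s, L i) := s.finite_toSet.isCompact_biUnion fun i _ => hL i
    refine Null_union (hL a).isClosed hs.isClosed
      (NoRel_of_subset_range 0 (hφ a) ((hL a).inter_right hs.isClosed)
        (inter_subset_left.trans (hLs a)))
      (Null_of_points_of_subset_range (hφ a) (hL a) (hLs a) fun x hx => hu x (Or.inl hx))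
      (ih fun x hx => hu x (Or.inr hx))

theorem exists_bd_of_points [CompactSpace M] (hM : PlaneCovered M) {u : SC 2 M}
    (hu : ∀ x, u ∈ Null 2 {x}) : ∃ v, u = bd v :=
  Null_univ (Null_of_points hM isCompact_univ fun x _ => hu x)

end Surface

end Excision

section FundamentalCycle

open Finsupp Set Topology

variable {M : Type*} [TopologicalSpace M]

theorem exists_box (hM : PlaneCovered M) {V : Set M} (hV : IsOpen V) {x : M} (hx : x ∈ V) :
    ∃ φ : C(ℝ × ℝ, M), IsOpenEmbedding φ ∧ ∃ p q : ℝ × ℝ, p ≤ q ∧ φ '' Icc p q ⊆ V ∧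
      φ '' Icc p q ∈ 𝓝 x := by
  obtain ⟨φ, hφ, rfl⟩ := hM x
  obtain ⟨ε, hε, h⟩ := Metric.nhds_basis_closedBall.mem_iff.1
    ((hV.preimage φ.continuous).mem_nhds hx)
  have hb : Metric.closedBall (0 : ℝ × ℝ) ε = Icc (0 - ε, 0 - ε) (0 + ε, 0 + ε) := by
    rw [← Prod.mk_zero_zero, ← closedBall_prod_same, Real.closedBall_eq_Icc, Icc_prod_eq]
  refine ⟨φ, hφ, (0 - ε, 0 - ε), (0 + ε, 0 + ε),
    ⟨by change 0 - ε ≤ 0 + ε; linarith, by change 0 - ε ≤ 0 + ε; linarith⟩, ?_, ?_⟩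
  · rw [← hb]
    exact image_subset_iff.2 h
  · rw [← hb]
    exact hφ.isOpenMap.image_mem_nhds (Metric.closedBall_mem_nhds 0 hε)

/-- A two-cycle generating the local homology at every point. -/
structure IsFund (z : SC 2 M) : Prop where
  bd_eq : bd z = 0
  notMem : ∀ x, z ∉ Null 2 {x}

theorem IsFund.bd_mem {z : SC 2 M} (hz : IsFund z) {S : Set M} : bd z ∈ Chn 1 S := by
  rw [hz.bd_eq]; exact Submodule.zero_mem _

/-- The local degree at `x` of a chain whose boundary misses `x`. -/
noncomputable def deg (z : SC 2 M) (x : M) (u : SC 2 M) : ℚ :=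
  Classical.epsilon fun q : ℚ => u - q • z ∈ Null 2 {x}

theorem deg_eq {z : SC 2 M} {x : M} (hz : IsFund z) {u : SC 2 M} {q : ℚ}
    (h : u - q • z ∈ Null 2 {x}) : deg z x u = q := by
  have h' : u - deg z x u • z ∈ Null 2 {x} :=
    Classical.epsilon_spec (p := fun q : ℚ => u - q • z ∈ Null 2 {x}) ⟨q, h⟩
  by_contra hne
  refine hz.notMem x ?_
  have := Submodule.smul_mem _ (q - deg z x u)⁻¹ (Submodule.sub_mem _ h' h)
  rwa [sub_sub_sub_cancel_left, ← sub_smul, smul_smul,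
    inv_mul_cancel₀ (sub_ne_zero.2 (Ne.symm hne)), one_smul] at this

variable [T2Space M]

theorem Null_box_of_point {φ : C(ℝ × ℝ, M)} (hφ : IsOpenEmbedding φ) {p q : ℝ × ℝ}
    {x : M} (hx : x ∈ φ '' Icc p q) {u : SC 2 M} (hu : bd u ∈ Chn 1 (φ '' Icc p q)ᶜ)
    (h : u ∈ Null 2 {x}) : u ∈ Null 2 (φ '' Icc p q) := by
  obtain ⟨r, hr, rfl⟩ := hx
  obtain ⟨u', h1, h2⟩ := exists_excise hφ (isClosed_image isCompact_Icc) hu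
  have h3 : u' ∈ Null 2 {r} := by
    refine mem_Null_of_push hφ (isClosed_image isCompact_singleton) ?_
    have := Submodule.sub_mem _ h
      (Null_mono (singleton_subset_iff.2 (mem_image_of_mem φ hr)) h2)
    rw [image_singleton]
    simpa using this
  simpa using Submodule.add_mem _ h2 (push_mem_Null hφ (Null_Icc_of_point hr h1 h3))

theorem exists_comb_Null (hM : PlaneCovered M) {x : M} {u v : SC 2 M}
    (hu : bd u ∈ Chn 1 {x}ᶜ) (hv : bd v ∈ Chn 1 {x}ᶜ) :
    ∃ s t : ℚ, (s ≠ 0 ∨ t ≠ 0) ∧ s • u + t • v ∈ Null 2 {x} := by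
  obtain ⟨φ, hφ, rfl⟩ := hM x
  have hr : φ '' Icc 0 0 = {φ 0} := by rw [Icc_self, image_singleton]
  rw [← hr] at hu hv ⊢
  obtain ⟨u', h1, h2⟩ := exists_excise hφ (isClosed_image isCompact_Icc) hu
  obtain ⟨v', h3, h4⟩ := exists_excise hφ (isClosed_image isCompact_Icc) hv
  obtain ⟨s, t, hst, h⟩ := exists_comb_Null_Icc le_rfl h1 h3
  refine ⟨s, t, hst, ?_⟩
  have := Submodule.add_mem _ (push_mem_Null hφ h)
    (Submodule.add_mem _ (Submodule.smul_mem _ s h2) (Submodule.smul_mem _ t h4))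
  convert this using 1
  rw [map_add, map_smul, map_smul]
  module

theorem Null_one_box {φ : C(ℝ × ℝ, M)} (hφ : IsOpenEmbedding φ) {p q : ℝ × ℝ}
    {u : SC 1 M} (hu : bd u ∈ Chn 0 (φ '' Icc p q)ᶜ) : u ∈ Null 1 (φ '' Icc p q) := by
  obtain ⟨u', h1, h2⟩ := exists_excise hφ (isClosed_image isCompact_Icc) hu
  simpa using Submodule.add_mem _ h2 (push_mem_Null hφ (Null_one_Icc h1))

theorem eventually_Null_iff (hM : PlaneCovered M) {x : M} {u : SC 2 M}
    (hu : bd u ∈ Chn 1 {x}ᶜ) : ∀ᶠ y in 𝓝 x, (u ∈ Null 2 {x} ↔ u ∈ Null 2 {y}) := by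
  obtain ⟨φ, hφ, p, q, -, h, hn⟩ := exists_box hM (isCompact_carrier (bd u)).isClosed.isOpen_compl
    (x := x) (fun hx => mem_Chn_iff.1 hu hx rfl)
  have hb : bd u ∈ Chn 1 (φ '' Icc p q)ᶜ := mem_Chn_iff.2 (subset_compl_comm.1 h)
  have key : ∀ y ∈ φ '' Icc p q, (u ∈ Null 2 {y} ↔ u ∈ Null 2 (φ '' Icc p q)) := fun y hy =>
    ⟨Null_box_of_point hφ hy hb, fun h => Null_mono (singleton_subset_iff.2 hy) h⟩
  filter_upwards [hn] with y hy
  rw [key x (mem_of_mem_nhds hn), key y hy]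

theorem isFund_of_not_bd [CompactSpace M] [PreconnectedSpace M] (hM : PlaneCovered M)
    {z : SC 2 M} (hz : bd z = 0) (h : ∀ v, z ≠ bd v) : IsFund z := by
  refine ⟨hz, ?_⟩
  have hb : ∀ x : M, bd z ∈ Chn 1 {x}ᶜ := fun x => by rw [hz]; exact Submodule.zero_mem _
  have hc : IsClopen {x : M | z ∈ Null 2 {x}} := by
    constructor
    · rw [← isOpen_compl_iff, isOpen_iff_mem_nhds]
      intro x hx
      filter_upwards [eventually_Null_iff hM (hb x)] with y hy hy'
      exact hx (hy.2 hy')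
    · rw [isOpen_iff_mem_nhds]
      intro x hx
      filter_upwards [eventually_Null_iff hM (hb x)] with y hy
      exact hy.1 hx
  rcases isClopen_iff.1 hc with h0 | h1
  · exact fun x hx => (h0.le hx : x ∈ (∅ : Set M))
  · obtain ⟨v, hv⟩ := exists_bd_of_points hM fun x => h1.ge (mem_univ x)
    exact absurd hv (h v)

section Degree

variable {z : SC 2 M} {x : M}

theorem deg_spec (hM : PlaneCovered M) (hz : IsFund z) {u : SC 2 M} (hu : bd u ∈ Chn 1 {x}ᶜ) :
    u - deg z x u • z ∈ Null 2 {x} := by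
  refine Classical.epsilon_spec (p := fun q : ℚ => u - q • z ∈ Null 2 {x}) ?_
  obtain ⟨s, t, hst, h⟩ := exists_comb_Null hM hu (v := z) (by
    rw [hz.bd_eq]; exact Submodule.zero_mem _)
  have hs : s ≠ 0 := by
    rintro rfl
    have ht : t ≠ 0 := by simpa using hst
    refine hz.notMem x ?_
    have := Submodule.smul_mem _ t⁻¹ h
    rwa [zero_smul, zero_add, smul_smul, inv_mul_cancel₀ ht, one_smul] at this
  refine ⟨-(s⁻¹ * t), ?_⟩
  have := Submodule.smul_mem _ s⁻¹ h
  rw [smul_add, smul_smul, smul_smul, inv_mul_cancel₀ hs, one_smul] at this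
  rwa [neg_smul, sub_neg_eq_add]

theorem deg_eq_zero_iff (hM : PlaneCovered M) (hz : IsFund z) {u : SC 2 M}
    (hu : bd u ∈ Chn 1 {x}ᶜ) : deg z x u = 0 ↔ u ∈ Null 2 {x} := by
  refine ⟨fun h => ?_, fun h => deg_eq hz (by simpa using h)⟩
  simpa [h] using deg_spec hM hz hu

theorem deg_sub (hM : PlaneCovered M) (hz : IsFund z) {u v : SC 2 M}
    (hu : bd u ∈ Chn 1 {x}ᶜ) (hv : bd v ∈ Chn 1 {x}ᶜ) :
    deg z x (u - v) = deg z x u - deg z x v := by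
  refine deg_eq hz ?_
  convert Submodule.sub_mem _ (deg_spec hM hz hu) (deg_spec hM hz hv) using 1
  module

theorem deg_add (hM : PlaneCovered M) (hz : IsFund z) {u v : SC 2 M}
    (hu : bd u ∈ Chn 1 {x}ᶜ) (hv : bd v ∈ Chn 1 {x}ᶜ) :
    deg z x (u + v) = deg z x u + deg z x v := by
  refine deg_eq hz ?_
  convert Submodule.add_mem _ (deg_spec hM hz hu) (deg_spec hM hz hv) using 1
  module

theorem deg_smul (hM : PlaneCovered M) (hz : IsFund z) (c : ℚ) {u : SC 2 M}
    (hu : bd u ∈ Chn 1 {x}ᶜ) : deg z x (c • u) = c * deg z x u := by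
  refine deg_eq hz ?_
  convert Submodule.smul_mem _ c (deg_spec hM hz hu) using 1
  module

theorem eventually_deg_eq (hM : PlaneCovered M) (hz : IsFund z) {u : SC 2 M}
    (hu : bd u ∈ Chn 1 {x}ᶜ) : ∀ᶠ y in 𝓝 x, deg z y u = deg z x u := by
  have h := deg_spec hM hz hu
  filter_upwards [eventually_Null_iff hM (bd_mem_of_mem_Null h)] with y hy
  exact deg_eq hz (hy.1 h)

theorem deg_eq_of_isPreconnected (hM : PlaneCovered M) (hz : IsFund z) {u : SC 2 M} {S : Set M}
    (hS : IsPreconnected S) (hu : bd u ∈ Chn 1 Sᶜ) {x y : M} (hx : x ∈ S) (hy : y ∈ S) :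
    deg z x u = deg z y u := by
  refine hS.induction₂ (fun x y => deg z x u = deg z y u) (fun x hx => ?_)
    (fun _ _ _ _ _ _ h h' => h.trans h') (fun _ _ _ _ h => h.symm) hx hy
  refine Filter.Eventually.filter_mono inf_le_left ?_
  filter_upwards [eventually_deg_eq hM hz (u := u) (x := x)
    (Chn_mono (compl_subset_compl.2 (singleton_subset_iff.2 hx)) hu)] with y hy
  exact hy.symm

end Degree

end FundamentalCycle

section FirstHomology

open Finsupp Set Topology

/-- The first singular homology group. -/
abbrev HOne (X : Type*) [TopologicalSpace X] : Type _ :=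
  LinearMap.ker (bd : SC 1 X →ₗ[ℚ] SC 0 X) ⧸
    (LinearMap.range (bd : SC 2 X →ₗ[ℚ] SC 1 X)).comap (LinearMap.ker bd).subtype

variable {M : Type*} [TopologicalSpace M]

theorem eq_zero_of_Chn_empty {n : ℕ} {u : SC n M} (hu : u ∈ Chn n (∅ : Set M)) : u = 0 :=
  eq_zero_of_Chn (disjoint_empty _) hu hu

theorem exists_bd_of_fillings [T2Space M] (hM : PlaneCovered M) {ι : Type*} [Finite ι]
    {K : ι → Set M} (hK : ∀ i, IsCompact (K i)) (hcov : ⋃ i, K i = univ) {d : SC 1 M}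
    {u : ι → SC 2 M} (hu : ∀ i, bd (u i) - d ∈ Chn 1 (K i)ᶜ)
    (h : ∀ i j, ∀ x ∈ K i ∩ K j, u i - u j ∈ Null 2 {x}) : ∃ v, bd v = d := by
  classical
  have := Fintype.ofFinite ι
  suffices H : ∀ s : Finset ι, ∃ v, bd v - d ∈ Chn 1 (⋃ i ∈ s, K i)ᶜ ∧
      ∀ i ∈ s, ∀ x ∈ K i, v - u i ∈ Null 2 {x} by
    obtain ⟨v, hv, -⟩ := H Finset.univ
    refine ⟨v, sub_eq_zero.1 (eq_zero_of_Chn_empty ?_)⟩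
    simpa [hcov] using hv
  intro s
  induction s using Finset.induction_on with
  | empty => exact ⟨0, by simpa using mem_Chn_univ _, by simp⟩
  | insert a s ha ih =>
    obtain ⟨v, hv, hvs⟩ := ih
    have hL : IsCompact (⋃ i ∈ s, K i) := s.finite_toSet.isCompact_biUnion fun i _ => hK i
    have hn : u a - v ∈ Null 2 (K a ∩ ⋃ i ∈ s, K i) := by
      refine Null_of_points hM ((hK a).inter_right hL.isClosed) fun x hx => ?_
      obtain ⟨hxa, hx⟩ := hx
      obtain ⟨i, hi, hxi⟩ := mem_iUnion₂.1 hx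
      have := Submodule.sub_mem _ (h a i x ⟨hxa, hxi⟩) (hvs i hi x hxi)
      rwa [sub_sub_sub_cancel_right] at this
    obtain ⟨w, hw, hwa, hwv⟩ := exists_glue (hK a).isClosed hL.isClosed hn (hu a) hv
    refine ⟨w, by rwa [Finset.set_biUnion_insert], fun i hi x hx => ?_⟩
    rcases Finset.mem_insert.1 hi with rfl | hi
    · exact Null_mono (singleton_subset_iff.2 hx) hwa
    · have := Submodule.add_mem _
        (Null_mono (singleton_subset_iff.2 (mem_iUnion₂.2 ⟨i, hi, hx⟩)) hwv) (hvs i hi x hx)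
      rwa [sub_add_sub_cancel] at this

/-- A finite cover by boxes together with shrunken compact sets. -/
structure BoxCover {ι : Type*} (V K : ι → Set M) : Prop where
  isOpen : ∀ i, IsOpen (V i)
  isCompact : ∀ i, IsCompact (K i)
  subset : ∀ i, K i ⊆ V i
  iUnion_eq : ⋃ i, K i = univ
  fill : ∀ i, ∀ c : SC 1 M, bd c = 0 → ∃ w : SC 2 M, bd w - c ∈ Chn 1 (V i)ᶜ

theorem exists_sample (hM : PlaneCovered M) {V K : Set M} (hV : IsOpen V) (hK : IsCompact K)
    (h : K ⊆ V) : ∃ t : Finset M, (t : Set M) ⊆ V ∧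
      ∀ x ∈ K, ∃ y ∈ t, ∃ S ⊆ V, IsPreconnected S ∧ x ∈ S ∧ y ∈ S := by
  have hbox : ∀ x ∈ K, ∃ S ⊆ V, IsPreconnected S ∧ S ∈ 𝓝 x := fun x hx => by
    obtain ⟨φ, -, p, q, -, hs, hn⟩ := exists_box hM hV (h hx)
    exact ⟨_, hs, (convex_Icc _ _).isPreconnected.image _ φ.continuous.continuousOn, hn⟩
  choose! S hSV hS hn using hbox
  obtain ⟨t, ht, htK⟩ := hK.elim_nhds_subcover S hn
  refine ⟨t, fun x hx => h (ht x hx), fun x hx => ?_⟩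
  obtain ⟨y, hy, hxy⟩ := mem_iUnion₂.1 (htK hx)
  exact ⟨y, hy, S y, hSV y (ht y hy), hS y (ht y hy), hxy, mem_of_mem_nhds (hn y (ht y hy))⟩

theorem bd_sub_mem_of_fillings {ι : Type*} {V : ι → Set M} {c : SC 1 M} {w : ι → SC 2 M}
    (h : ∀ i, bd (w i) - c ∈ Chn 1 (V i)ᶜ) (i j : ι) :
    bd (w i - w j) ∈ Chn 1 (V i ∩ V j)ᶜ := by
  have : bd (w i - w j) = (bd (w i) - c) - (bd (w j) - c) := by rw [map_sub]; abel
  rw [this]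
  exact Submodule.sub_mem _ (Chn_mono (compl_subset_compl.2 inter_subset_left) (h i))
    (Chn_mono (compl_subset_compl.2 inter_subset_right) (h j))

variable [T2Space M]

theorem exists_boxCover [CompactSpace M] (hM : PlaneCovered M) :
    ∃ (t : Finset M) (V K : t → Set M), BoxCover V K := by
  choose φ hφ p q _ _ hn using fun x => exists_box hM isOpen_univ (mem_univ (x : M))
  obtain ⟨t, ht⟩ := (isCompact_univ (X := M)).elim_finite_subcover
    (fun x => interior (φ x '' Icc (p x) (q x))) (fun x => isOpen_interior)
    fun x _ => mem_iUnion.2 ⟨x, mem_interior_iff_mem_nhds.2 (hn x)⟩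
  obtain ⟨L, hL, hLs, hLt⟩ := isCompact_univ.finite_compact_cover t
    (fun x => interior (φ x '' Icc (p x) (q x))) (fun x _ => isOpen_interior) ht
  refine ⟨t, fun x => interior (φ x '' Icc (p x) (q x)), fun x => L x, fun _ => isOpen_interior,
    fun x => hL x, fun x => hLs x, ?_, fun x c hc => ?_⟩
  · rw [hLt, iUnion_subtype]
  · obtain ⟨v, o, ho, hv⟩ := mem_Null.1 (Null_one_box (hφ x) (u := c)
      (by rw [hc]; exact Submodule.zero_mem _))
    refine ⟨v, ?_⟩
    rw [hv, sub_add_cancel_left]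
    exact Submodule.neg_mem _ (Chn_mono (compl_subset_compl.2 interior_subset) ho)

/-- Cycles with a choice of local fillings. -/
def fillings {ι : Type*} (V : ι → Set M) : Submodule ℚ (SC 1 M × (ι → SC 2 M)) where
  carrier := {cw | bd cw.1 = 0 ∧ ∀ i, bd (cw.2 i) - cw.1 ∈ Chn 1 (V i)ᶜ}
  zero_mem' := ⟨map_zero _, fun i => by simp⟩
  add_mem' := by
    rintro ⟨c, w⟩ ⟨c', w'⟩ ⟨h, h1⟩ ⟨h', h1'⟩
    refine ⟨by simp_all, fun i => ?_⟩
    convert Submodule.add_mem _ (h1 i) (h1' i) using 1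
    simp only [Prod.mk_add_mk, Pi.add_apply, map_add]
    abel
  smul_mem' := by
    rintro a ⟨c, w⟩ ⟨h, h1⟩
    refine ⟨by simp_all, fun i => ?_⟩
    convert Submodule.smul_mem _ a (h1 i) using 1
    simp only [Prod.smul_mk, Pi.smul_apply, map_smul, smul_sub]

theorem finite_HOne [CompactSpace M] (hM : PlaneCovered M) {z : SC 2 M} (hz : IsFund z) :
    Module.Finite ℚ (HOne M) := by
  obtain ⟨ι, V, K, hVK⟩ := exists_boxCover hM
  choose t htV ht using fun i j => exists_sample hM ((hVK.isOpen i).inter (hVK.isOpen j))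
    ((hVK.isCompact i).inter (hVK.isCompact j)) (inter_subset_inter (hVK.subset i) (hVK.subset j))
  have hb : ∀ P : fillings V, ∀ i j, ∀ x ∈ V i ∩ V j, bd (P.1.2 i - P.1.2 j) ∈ Chn 1 {x}ᶜ :=
    fun P i j x hx => Chn_mono (compl_subset_compl.2 (singleton_subset_iff.2 hx))
      (bd_sub_mem_of_fillings P.2.2 i j)
  let T : fillings V →ₗ[ℚ] ∀ i j, t i j → ℚ :=
    { toFun := fun P i j y => deg z y (P.1.2 i - P.1.2 j)
      map_add' := fun P Q => by
        funext i j y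
        have hy := htV i j y.2
        change deg z y.1 ((P.1.2 i + Q.1.2 i) - (P.1.2 j + Q.1.2 j)) = _
        rw [add_sub_add_comm, deg_add hM hz (hb P i j y hy) (hb Q i j y hy)]
        rfl
      map_smul' := fun a P => by
        funext i j y
        change deg z y.1 (a • P.1.2 i - a • P.1.2 j) = _
        rw [← smul_sub, deg_smul hM hz a (hb P i j y (htV i j y.2))]
        rfl }
  let π : fillings V →ₗ[ℚ] HOne M := (Submodule.mkQ _).comp
    (((LinearMap.fst ℚ _ _).comp (fillings V).subtype).codRestrict _ fun P => P.2.1)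
  have hπ : Function.Surjective π := by
    intro c
    obtain ⟨⟨c, hc⟩, rfl⟩ := Submodule.mkQ_surjective _ c
    choose w hw using fun i => hVK.fill i c hc
    exact ⟨⟨(c, w), hc, hw⟩, rfl⟩
  have hker : LinearMap.ker T ≤ LinearMap.ker π := by
    intro P hP
    have hP : T P = 0 := hP
    obtain ⟨v, hv⟩ := exists_bd_of_fillings hM hVK.isCompact hVK.iUnion_eq (d := P.1.1)
      (u := P.1.2) (fun i => Chn_mono (compl_subset_compl.2 (hVK.subset i)) (P.2.2 i))
      fun i j x hx => by
        obtain ⟨y, hy, S, hS, hSc, hxS, hyS⟩ := ht i j x hx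
        rw [← deg_eq_zero_iff hM hz (hb P i j x (hS hxS)), deg_eq_of_isPreconnected hM hz hSc
          (Chn_mono (compl_subset_compl.2 hS) (bd_sub_mem_of_fillings P.2.2 i j)) hxS hyS]
        exact congrFun (congrFun (congrFun hP i) j) ⟨y, hy⟩
    exact (Submodule.Quotient.mk_eq_zero _).2 ⟨v, hv⟩
  have := Module.Finite.equiv T.quotKerEquivRange.symm
  exact Module.Finite.of_surjective ((LinearMap.ker T).liftQ π hker) fun c => by
    obtain ⟨P, rfl⟩ := hπ c
    exact ⟨Submodule.Quotient.mk P, rfl⟩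

end FirstHomology

section CapProduct

open Finsupp Set Topology

variable {X : Type*} [TopologicalSpace X]

theorem exists_comp_eq_of_ker_le {V W : Type*} [AddCommGroup V] [Module ℚ V] [AddCommGroup W]
    [Module ℚ W] (g : V →ₗ[ℚ] W) (f : V →ₗ[ℚ] ℚ) (h : LinearMap.ker g ≤ LinearMap.ker f) :
    ∃ φ : W →ₗ[ℚ] ℚ, ∀ v, f v = φ (g v) := by
  have : f ∈ LinearMap.range g.dualMap := by
    rw [LinearMap.range_dualMap_eq_dualAnnihilator_ker, Submodule.mem_dualAnnihilator]
    exact fun v hv => h hv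
  obtain ⟨φ, rfl⟩ := this
  exact ⟨φ, fun v => rfl⟩

/-- The simplex spanned by some of the vertices of a singular simplex. -/
noncomputable def ρ {m n : ℕ} (σ : C(Simp n, X)) (f : Fin (m + 1) → Fin (n + 1)) :
    C(Simp m, X) := σ.comp (smap f)

theorem ρ_ρ {l m n : ℕ} (σ : C(Simp n, X)) (f : Fin (m + 1) → Fin (n + 1))
    (g : Fin (l + 1) → Fin (m + 1)) : ρ (ρ σ f) g = ρ σ (f ∘ g) := by
  rw [ρ, ρ, ρ, ContinuousMap.comp_assoc, smap_comp]

theorem ρ_vtx {m n : ℕ} (σ : C(Simp n, X)) (f : Fin (m + 1) → Fin (n + 1)) (i : Fin (m + 1)) :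
    ρ σ f (vtx i) = σ (vtx (f i)) := congrArg σ (smap_vtx f i)

theorem ρ_mem {m n : ℕ} {σ : C(Simp n, X)} {S : Set X} (h : ∀ t, σ t ∈ S)
    (f : Fin (m + 1) → Fin (n + 1)) (t : Simp m) : ρ σ f t ∈ S := h _

theorem bd_single_two (σ : C(Simp 2, X)) : bd (single σ 1) =
    single (ρ σ ![1, 2]) 1 - single (ρ σ ![0, 2]) 1 + single (ρ σ ![0, 1]) 1 := by
  rw [bd_single, Fin.sum_univ_three]
  have h0 : face 0 σ = ρ σ ![1, 2] := congrArg (ρ σ) (by decide)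
  have h1 : face 1 σ = ρ σ ![0, 2] := congrArg (ρ σ) (by decide)
  have h2 : face 2 σ = ρ σ ![0, 1] := congrArg (ρ σ) (by decide)
  rw [h0, h1, h2]
  simp [sub_eq_add_neg]

theorem bd_single_three (σ : C(Simp 3, X)) : bd (single σ 1) =
    single (ρ σ ![1, 2, 3]) 1 - single (ρ σ ![0, 2, 3]) 1 + single (ρ σ ![0, 1, 3]) 1 -
      single (ρ σ ![0, 1, 2]) 1 := by
  rw [bd_single, Fin.sum_univ_four]
  have h0 : face 0 σ = ρ σ ![1, 2, 3] := congrArg (ρ σ) (by decide)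
  have h1 : face 1 σ = ρ σ ![0, 2, 3] := congrArg (ρ σ) (by decide)
  have h2 : face 2 σ = ρ σ ![0, 1, 3] := congrArg (ρ σ) (by decide)
  have h3 : face 3 σ = ρ σ ![0, 1, 2] := congrArg (ρ σ) (by decide)
  rw [h0, h1, h2, h3]
  have : (-1 : ℚ) ^ ((3 : Fin 4) : ℕ) = -1 := by norm_num [show ((3 : Fin 4) : ℕ) = 3 from rfl]
  rw [this]
  simp [sub_eq_add_neg]

/-- Multiplication of the coefficients of a chain by a function of the simplices. -/
noncomputable def wt {n m : ℕ} (a : C(Simp n, X) → ℚ) (r : C(Simp n, X) → C(Simp m, X)) :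
    SC n X →ₗ[ℚ] SC m X := linearCombination ℚ fun σ => a σ • single (r σ) 1

theorem wt_single {n m : ℕ} (a : C(Simp n, X) → ℚ) (r : C(Simp n, X) → C(Simp m, X))
    (σ : C(Simp n, X)) : wt a r (single σ 1) = a σ • single (r σ) 1 := by
  rw [wt, linearCombination_single, one_smul]

/-- Cap product of two-chains with a one-cochain. -/
noncomputable def capTwo (f : SC 1 X →ₗ[ℚ] ℚ) : SC 2 X →ₗ[ℚ] SC 1 X :=
  wt (fun σ => f (single (ρ σ ![1, 2]) 1)) fun σ => ρ σ ![0, 1]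

/-- Cap product of three-chains with a one-cochain. -/
noncomputable def capThree (f : SC 1 X →ₗ[ℚ] ℚ) : SC 3 X →ₗ[ℚ] SC 2 X :=
  wt (fun σ => f (single (ρ σ ![2, 3]) 1)) fun σ => ρ σ ![0, 1, 2]

theorem capTwo_single (f : SC 1 X →ₗ[ℚ] ℚ) (σ : C(Simp 2, X)) :
    capTwo f (single σ 1) = f (single (ρ σ ![1, 2]) 1) • single (ρ σ ![0, 1]) 1 := wt_single _ _ _

section Cocycle

variable {f : SC 1 X →ₗ[ℚ] ℚ}

theorem cocycle_apply (hf : ∀ v : SC 2 X, f (bd v) = 0) (σ : C(Simp 2, X)) :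
    f (single (ρ σ ![0, 2]) 1) =
    f (single (ρ σ ![0, 1]) 1) + f (single (ρ σ ![1, 2]) 1) := by
  have := hf (single σ 1)
  rw [bd_single_two, map_add, map_sub] at this
  linarith

theorem bd_capThree (hf : ∀ v : SC 2 X, f (bd v) = 0) (v : SC 3 X) :
    bd (capThree f v) = capTwo f (bd v) := by
  suffices H : bd.comp (capThree f) = (capTwo f).comp bd from DFunLike.congr_fun H v
  refine hom_ext fun σ => ?_
  have h := cocycle_apply hf (ρ σ ![1, 2, 3])
  simp only [ρ_ρ] at h
  rw [LinearMap.comp_apply, LinearMap.comp_apply, capThree, wt_single, bd_single_three, map_smul,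
    bd_single_two, map_sub, map_add, map_sub, capTwo_single, capTwo_single, capTwo_single,
    capTwo_single]
  simp only [ρ_ρ]
  have a1 : (![1, 2, 3] : Fin 3 → Fin 4) ∘ ![1, 2] = ![2, 3] := by decide
  have a2 : (![1, 2, 3] : Fin 3 → Fin 4) ∘ ![0, 1] = ![1, 2] := by decide
  have a3 : (![1, 2, 3] : Fin 3 → Fin 4) ∘ ![0, 2] = ![1, 3] := by decide
  have a4 : (![0, 2, 3] : Fin 3 → Fin 4) ∘ ![1, 2] = ![2, 3] := by decide
  have a5 : (![0, 2, 3] : Fin 3 → Fin 4) ∘ ![0, 1] = ![0, 2] := by decide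
  have a6 : (![0, 1, 3] : Fin 3 → Fin 4) ∘ ![1, 2] = ![1, 3] := by decide
  have a7 : (![0, 1, 3] : Fin 3 → Fin 4) ∘ ![0, 1] = ![0, 1] := by decide
  have a8 : (![0, 1, 2] : Fin 3 → Fin 4) ∘ ![1, 2] = ![1, 2] := by decide
  have a9 : (![0, 1, 2] : Fin 3 → Fin 4) ∘ ![0, 1] = ![0, 1] := by decide
  have a10 : (![0, 1, 2] : Fin 3 → Fin 4) ∘ ![0, 2] = ![0, 2] := by decide
  rw [a1, a2, a3] at h
  rw [a1, a2, a4, a5, a6, a7, a8, a9, a10, h]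
  module

theorem apply_capTwo_self (hf : ∀ v : SC 2 X, f (bd v) = 0) {u : SC 2 X}
    (hu : bd u = 0) : f (capTwo f u) = 0 := by
  let q : SC 1 X →ₗ[ℚ] ℚ := linearCombination ℚ fun e => f (single e 1) ^ 2
  have hq : ∀ e, q (single e 1) = f (single e 1) ^ 2 := fun e => by
    simp [q]
  have H : f.comp (capTwo f) = (-(1 / 2 : ℚ)) • q.comp bd := by
    refine hom_ext fun σ => ?_
    rw [LinearMap.comp_apply, LinearMap.smul_apply, LinearMap.comp_apply, capTwo_single,
      map_smul, bd_single_two, map_add, map_sub, hq, hq, hq, cocycle_apply hf, smul_eq_mul,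
      smul_eq_mul]
    ring
  have := DFunLike.congr_fun H u
  simpa [hu] using this

end Cocycle

/-- Cap product of two-chains with a zero-cochain. -/
noncomputable def capZero (ψ : X → ℚ) : SC 2 X →ₗ[ℚ] SC 2 X :=
  wt (fun σ => ψ (σ (vtx 2))) fun σ => σ

/-- The coboundary of a zero-cochain. -/
noncomputable def cobd (ψ : X → ℚ) : SC 1 X →ₗ[ℚ] ℚ :=
  linearCombination ℚ fun e => ψ (e (vtx 1)) - ψ (e (vtx 0))

theorem cobd_single (ψ : X → ℚ) (e : C(Simp 1, X)) :
    cobd ψ (single e 1) = ψ (e (vtx 1)) - ψ (e (vtx 0)) := by simp [cobd]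

theorem cobd_bd (ψ : X → ℚ) (v : SC 2 X) : cobd ψ (bd v) = 0 := by
  suffices H : (cobd ψ).comp bd = 0 from DFunLike.congr_fun H v
  refine hom_ext fun σ => ?_
  rw [LinearMap.comp_apply, bd_single_two, map_add, map_sub, cobd_single, cobd_single, cobd_single]
  simp [ρ_vtx]

theorem bd_capZero (ψ : X → ℚ) {u : SC 2 X} (hu : bd u = 0) :
    bd (capZero ψ u) = capTwo (cobd ψ) u := by
  have H : bd.comp (capZero ψ) =
      (wt (fun e : C(Simp 1, X) => ψ (e (vtx 1))) fun e => e).comp bd + capTwo (cobd ψ) := by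
    refine hom_ext fun σ => ?_
    rw [LinearMap.add_apply, LinearMap.comp_apply, LinearMap.comp_apply, capZero, wt_single,
      map_smul, bd_single_two, map_add, map_sub, wt_single, wt_single, wt_single, capTwo_single,
      cobd_single]
    simp only [ρ_vtx, Matrix.cons_val_one, Matrix.cons_val_zero]
    module
  have := DFunLike.congr_fun H u
  simpa [hu] using this

theorem eq_of_locally_const {ψ : X → ℚ} {S : Set X} (hS : IsPreconnected S)
    (h : ∀ x ∈ S, ∀ᶠ y in 𝓝 x, ψ y = ψ x) {x y : X} (hx : x ∈ S) (hy : y ∈ S) : ψ x = ψ y :=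
  hS.induction₂ (fun x y => ψ x = ψ y)
    (fun x hx => Filter.Eventually.filter_mono inf_le_left ((h x hx).mono fun _ hy => hy.symm))
    (fun _ _ _ _ _ _ h h' => h.trans h') (fun _ _ _ _ h => h.symm) hx hy

/-- Local potentials with locally constant differences define a one-cocycle. -/
theorem exists_cocycle {κ : Type*} {U : κ → Set X} (hU : ∀ k, IsOpen (U k))
    (hcov : ⋃ k, U k = univ) (ψ : κ → X → ℚ)
    (hψ : ∀ k l, ∀ x ∈ U k ∩ U l, ∀ᶠ y in 𝓝 x, ψ k y - ψ l y = ψ k x - ψ l x) :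
    ∃ f : SC 1 X →ₗ[ℚ] ℚ, (∀ v : SC 2 X, f (bd v) = 0) ∧
      ∀ k, ∀ e : C(Simp 1, X), (∀ t, e t ∈ U k) → f (single e 1) = cobd (ψ k) (single e 1) := by
  classical
  let α : SC 1 X →ₗ[ℚ] ℚ := linearCombination ℚ fun e =>
    if h : ∃ k, ∀ t, e t ∈ U k then cobd (ψ h.choose) (single e 1) else 0
  have hα : ∀ k, ∀ e : C(Simp 1, X), (∀ t, e t ∈ U k) →
      α (single e 1) = cobd (ψ k) (single e 1) := by
    intro k e he
    have h : ∃ k, ∀ t, e t ∈ U k := ⟨k, he⟩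
    have h1 : α (single e 1) = cobd (ψ h.choose) (single e 1) := by
      change linearCombination ℚ _ (single e 1) = _
      rw [linearCombination_single, one_smul]
      exact dif_pos h
    rw [h1, cobd_single, cobd_single]
    have := eq_of_locally_const (ψ := fun x => ψ h.choose x - ψ k x)
      (isPreconnected_range e.continuous)
      (by
        rintro _ ⟨t, rfl⟩
        exact hψ _ _ _ ⟨h.choose_spec t, he t⟩)
      (mem_range_self (vtx 1)) (mem_range_self (vtx 0))
    linarith
  have hbd : ∀ v ∈ Sml 2 U, α (bd v) = 0 := by
    intro v hv
    refine eq_of_supported (α.comp bd) 0 (fun σ hσ => ?_) hv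
    obtain ⟨k, hk⟩ := hσ
    have := cobd_bd (ψ k) (single σ 1)
    rw [bd_single_two, map_add, map_sub] at this
    rw [LinearMap.comp_apply, bd_single_two, map_add, map_sub, hα k _ (ρ_mem hk _),
      hα k _ (ρ_mem hk _), hα k _ (ρ_mem hk _), this, LinearMap.zero_apply]
  obtain ⟨φ, hφ⟩ := exists_comp_eq_of_ker_le
    ((LinearMap.range (bd : SC 2 X →ₗ[ℚ] SC 1 X)).mkQ.comp (Sml 1 U).subtype)
    (α.comp (Sml 1 U).subtype) (by
      rintro ⟨u, hu⟩ h
      obtain ⟨v, rfl⟩ := (Submodule.Quotient.mk_eq_zero _).1 h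
      obtain ⟨N, hN⟩ := exists_sd_small (u := v) hU (by rw [hcov]; exact mem_Chn_univ v)
      change α (bd v) = 0
      have h1 := bd_sTN N (bd v)
      rw [bd_bd, map_zero, sub_zero, ← bd_sd_pow] at h1
      rw [← sub_add_cancel (bd v) (bd ((sd ^ N) v)), map_add, hbd _ hN, ← h1,
        hbd _ (sTN_Sml N hu), add_zero])
  refine ⟨φ.comp (Submodule.mkQ _), fun v => ?_, fun k e he => ?_⟩
  · have hm : bd v ∈ LinearMap.range (bd : SC 2 X →ₗ[ℚ] SC 1 X) := ⟨v, rfl⟩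
    rw [LinearMap.comp_apply, Submodule.mkQ_apply, (Submodule.Quotient.mk_eq_zero _).2 hm,
      map_zero]
  · rw [← hα k e he]
    exact (hφ ⟨single e 1, single_mem_supported ℚ _ ⟨k, he⟩⟩).symm

end CapProduct

section Duality

open Finsupp Set Topology

variable {M : Type*} [TopologicalSpace M] [T2Space M] {z : SC 2 M}

/-- A system of local fillings of a one-cycle determines a Poincaré dual cocycle. -/
theorem exists_dual_of_fillings (hM : PlaneCovered M) (hz : IsFund z) {κ : Type*} [Finite κ]
    {V K : κ → Set M} (hV : ∀ k, IsOpen (V k)) (hK : ∀ k, IsCompact (K k))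
    (hKV : ∀ k, K k ⊆ V k) (hcov : ⋃ k, K k = univ) {c : SC 1 M} {w : κ → SC 2 M}
    (hw : ∀ k, bd (w k) - c ∈ Chn 1 (V k)ᶜ) (i : M → κ) (hi : ∀ x, x ∈ V (i x)) :
    ∃ f : SC 1 M →ₗ[ℚ] ℚ, (∀ v : SC 2 M, f (bd v) = 0) ∧
      (∀ k, ∀ e : C(Simp 1, M), (∀ t, e t ∈ V k ∧ i (e t) = k) → f (single e 1) = 0) ∧
      ∃ v, capTwo f z - c = bd v := by
  have hb : ∀ k l x, x ∈ V k → x ∈ V l → bd (w k - w l) ∈ Chn 1 {x}ᶜ := fun k l x hk hl =>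
    Chn_mono (compl_subset_compl.2 (singleton_subset_iff.2 (mem_inter hk hl)))
      (bd_sub_mem_of_fillings hw k l)
  let ψ : κ → M → ℚ := fun k x => deg z x (w k - w (i x))
  have hψ : ∀ k l x, x ∈ V k → x ∈ V l → ψ k x - ψ l x = deg z x (w k - w l) := by
    intro k l x hk hl
    rw [← deg_sub hM hz (hb k (i x) x hk (hi x)) (hb l (i x) x hl (hi x)), sub_sub_sub_cancel_right]
  have hloc : ∀ k l, ∀ x ∈ V k ∩ V l, ∀ᶠ y in 𝓝 x, ψ k y - ψ l y = ψ k x - ψ l x := by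
    rintro k l x ⟨hk, hl⟩
    filter_upwards [(hV k).mem_nhds hk, (hV l).mem_nhds hl,
      eventually_deg_eq hM hz (hb k l x hk hl)]
      with y hyk hyl hy
    rw [hψ k l y hyk hyl, hψ k l x hk hl, hy]
  obtain ⟨f, hf, hfψ⟩ := exists_cocycle hV
    (eq_univ_of_univ_subset (hcov ▸ iUnion_mono hKV)) ψ hloc
  refine ⟨f, hf, fun k e he => ?_, ?_⟩
  · have h0 : ∀ t, ψ k (e t) = 0 := fun t => by
      change deg z _ (w k - w (i (e t))) = 0
      rw [(he t).2, sub_self]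
      exact deg_eq hz (by simp)
    rw [hfψ k e fun t => (he t).1, cobd_single, h0, h0, sub_zero]
  classical
  let U : M → Set M := fun x => ⋂ k, if x ∈ K k then V k else (K k)ᶜ
  have hUo : ∀ x, IsOpen (U x) := fun x => isOpen_iInter_of_finite fun k => by
    split_ifs
    exacts [hV k, (hK k).isClosed.isOpen_compl]
  have hUx : ∀ x, x ∈ U x := fun x => mem_iInter.2 fun k => by
    split_ifs with h
    exacts [hKV k h, h]
  obtain ⟨N, hN⟩ := exists_sd_small (u := z) hUo (by
    rw [eq_univ_of_forall fun x => mem_iUnion.2 ⟨x, hUx x⟩]; exact mem_Chn_univ z)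
  have hbz : bd ((sd ^ N) z) = 0 := by rw [bd_sd_pow, hz.bd_eq, map_zero]
  have hsm : ∀ k, ∀ σ : C(Simp 2, M), (∃ x, ∀ t, σ t ∈ U x) →
      (∀ t, σ t ∈ V k) ∨ ∀ t, σ t ∈ (K k)ᶜ := by
    rintro k σ ⟨x, hx⟩
    have := fun t => mem_iInter.1 (hx t) k
    by_cases h : x ∈ K k
    · exact Or.inl (by simpa [h] using this)
    · exact Or.inr (by simpa [h] using this)
  have h1 : ∀ k, capTwo (cobd (ψ k)) ((sd ^ N) z) - capTwo f ((sd ^ N) z) ∈ Chn 1 (K k)ᶜ := by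
    intro k
    refine map_mem_of_supported (capTwo (cobd (ψ k)) - capTwo f) _ (fun σ hσ => ?_) hN
    rw [LinearMap.sub_apply, capTwo_single, capTwo_single]
    rcases hsm k σ hσ with h | h
    · rw [hfψ k _ (ρ_mem h _), sub_self]
      exact Submodule.zero_mem _
    · have := single_mem_Chn (ρ_mem h ![0, 1]) (1 : ℚ)
      exact Submodule.sub_mem _ (Submodule.smul_mem _ _ this) (Submodule.smul_mem _ _ this)
  have h2 : ∀ k l, ∀ x ∈ K k ∩ K l, capZero (ψ k) ((sd ^ N) z) - capZero (ψ l) ((sd ^ N) z) -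
      deg z x (w k - w l) • (sd ^ N) z ∈ Chn 2 {x}ᶜ := by
    rintro k l x ⟨hk, hl⟩
    refine map_mem_of_supported (capZero (ψ k) - capZero (ψ l) - deg z x (w k - w l) • LinearMap.id)
      _ (fun σ hσ => ?_) hN
    rw [LinearMap.sub_apply, LinearMap.sub_apply, capZero, capZero, wt_single, wt_single,
      LinearMap.smul_apply, LinearMap.id_apply, ← sub_smul, ← sub_smul]
    by_cases hx : ∃ t, σ t = x
    · obtain ⟨t, rfl⟩ := hx
      have hk' := (hsm k σ hσ).resolve_right fun h => h t hk
      have hl' := (hsm l σ hσ).resolve_right fun h => h t hl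
      have := eq_of_locally_const (ψ := fun x => ψ k x - ψ l x) (isPreconnected_range σ.continuous)
        (by
          rintro _ ⟨t, rfl⟩
          exact hloc _ _ _ ⟨hk' t, hl' t⟩)
        (mem_range_self (vtx 2)) (mem_range_self t)
      rw [this, hψ k l _ (hk' t) (hl' t), sub_self, zero_smul]
      exact Submodule.zero_mem _
    · exact Submodule.smul_mem _ _ (single_mem_Chn (S := {x}ᶜ) (fun t ht => hx ⟨t, ht⟩) 1)
  obtain ⟨v, hv⟩ := exists_bd_of_fillings hM hK hcov (d := capTwo f ((sd ^ N) z) - c)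
    (u := fun k => capZero (ψ k) ((sd ^ N) z) - w k) (fun k => by
      rw [map_sub, bd_capZero _ hbz]
      convert Submodule.sub_mem _ (h1 k) (Chn_mono (compl_subset_compl.2 (hKV k)) (hw k)) using 1
      abel) (fun k l x hx => by
      have e1 := mem_Null_of_Chn (h2 k l x hx)
      have e2 := deg_spec hM hz (hb k l x (hKV k hx.1) (hKV l hx.2))
      have e3 := sub_sd_mem_Null (K := {x}) (hz.bd_mem) N
      convert Submodule.sub_mem _ (Submodule.sub_mem _ e1 e2)
        (Submodule.smul_mem _ (deg z x (w k - w l)) e3) using 1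
      module)
  refine ⟨capThree f (sTN N z) + v, ?_⟩
  have := bd_sTN N z
  rw [hz.bd_eq, map_zero, sub_zero] at this
  rw [map_add, hv, bd_capThree hf, this, map_sub]
  abel

/-- Poincaré duality for a one-cycle carried by a closed set. -/
theorem exists_dual [CompactSpace M] (hM : PlaneCovered M) (hz : IsFund z) {c : SC 1 M}
    (hc : bd c = 0) {C : Set M} (hC : IsClosed C) (hcC : c ∈ Chn 1 C) :
    ∃ f : SC 1 M →ₗ[ℚ] ℚ, (∀ v : SC 2 M, f (bd v) = 0) ∧
      (∀ e : C(Simp 1, M), (∀ t, e t ∉ C) → f (single e 1) = 0) ∧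
      ∃ v, capTwo f z - c = bd v := by
  classical
  obtain ⟨ι, V, K, hVK⟩ := exists_boxCover hM
  choose w hw using fun i => hVK.fill i c hc
  choose j hj using fun x => mem_iUnion.1 (hVK.iUnion_eq.symm ▸ mem_univ x)
  obtain ⟨f, hf, h1, h2⟩ := exists_dual_of_fillings hM hz
    (V := fun k : Option ι => k.elim Cᶜ V) (K := fun k : Option ι => k.elim ∅ K)
    (w := fun k : Option ι => k.elim 0 w) (c := c)
    (by rintro (_ | k); exacts [hC.isOpen_compl, hVK.isOpen k])
    (by rintro (_ | k); exacts [isCompact_empty, hVK.isCompact k])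
    (by rintro (_ | k); exacts [empty_subset _, hVK.subset k])
    (by rw [iUnion_option]; simpa using hVK.iUnion_eq)
    (by
      rintro (_ | k)
      · simpa using hcC
      · exact hw k)
    (fun x => if x ∈ C then some (j x) else none)
    (fun x => by
      by_cases hx : x ∈ C
      · simpa [hx] using hVK.subset _ (hj x)
      · simp [hx])
  refine ⟨f, hf, fun e he => h1 none e fun t => ⟨he t, if_neg (he t)⟩, h2⟩

end Duality

section CircleCycles

open Finsupp Set Topology

section CircleCycle

theorem eq_single_pt {X : Type*} [TopologicalSpace X] (σ : C(Simp 0, X)) :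
    σ = pt (σ (vtx 0)) := by
  ext t
  exact congrArg σ (Subsingleton.elim _ _)

theorem face_one_eq {X : Type*} [TopologicalSpace X] (e : C(Simp 1, X)) (i : Fin 2) :
    face i e = pt (e (vtx (i.succAbove 0))) := by
  rw [eq_single_pt (face i e)]
  exact congrArg (fun t => pt (e t)) (smap_vtx _ _)

/-- A half circle. -/
noncomputable def arc (a : ℝ) : C(Simp 1, Circle) where
  toFun t := Circle.exp (Real.pi * (t 1 + a))
  continuous_toFun := by
    refine Circle.exp.continuous.comp (continuous_const.mul (Continuous.add ?_ continuous_const))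
    exact (continuous_apply 1).comp continuous_subtype_val

/-- The fundamental cycle of the circle. -/
noncomputable def circleCycle : SC 1 Circle := single (arc 0) 1 + single (arc 1) 1

theorem bd_circleCycle : bd circleCycle = 0 := by
  have h0 : arc 0 (vtx 0) = 1 := by simp [arc]
  have h1 : arc 0 (vtx 1) = Circle.exp Real.pi := by simp [arc]
  have h2 : arc 1 (vtx 0) = Circle.exp Real.pi := by simp [arc]
  have h3 : arc 1 (vtx 1) = 1 := by
    simp [arc, mul_add, -Circle.exp_add, ← two_mul]
  rw [circleCycle, map_add, bd_single_one, bd_single_one]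
  simp only [face_one_eq]
  have s0 : (0 : Fin 2).succAbove 0 = (1 : Fin 2) := rfl
  have s1 : (1 : Fin 2).succAbove 0 = (0 : Fin 2) := rfl
  rw [s0, s1, h0, h1, h2, h3]
  abel

theorem exists_circle_cocycle : ∃ f : SC 1 Circle →ₗ[ℚ] ℚ, (∀ v : SC 2 Circle, f (bd v) = 0) ∧
    f circleCycle = 1 := by
  let U : Bool → Set Circle := fun b =>
    if b then {s | (s : ℂ).re ≠ 0} ∪ {s | 0 < (s : ℂ).im}
    else {s | (s : ℂ).re ≠ 0} ∪ {s | (s : ℂ).im < 0}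
  have hre : Continuous fun s : Circle => (s : ℂ).re :=
    Complex.continuous_re.comp continuous_subtype_val
  have him : Continuous fun s : Circle => (s : ℂ).im :=
    Complex.continuous_im.comp continuous_subtype_val
  have ho : ∀ b, IsOpen (U b) := by
    rintro (_ | _)
    · exact (isOpen_ne_fun hre continuous_const).union (isOpen_lt him continuous_const)
    · exact (isOpen_ne_fun hre continuous_const).union (isOpen_lt continuous_const him)
  have hsq : ∀ s : Circle, (s : ℂ).re = 0 → (s : ℂ).im ≠ 0 := by
    intro s h h'
    have := Circle.normSq_coe s
    rw [Complex.normSq_apply, h, h'] at this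
    norm_num at this
  have hcov : ⋃ b, U b = univ := by
    refine eq_univ_of_forall fun s => ?_
    by_cases h : (s : ℂ).re = 0
    · rcases (hsq s h).lt_or_gt with h' | h'
      · exact mem_iUnion.2 ⟨false, Or.inr h'⟩
      · exact mem_iUnion.2 ⟨true, Or.inr h'⟩
    · exact mem_iUnion.2 ⟨true, Or.inl h⟩
  let ψ : Bool → Circle → ℚ := fun b s => if b then 0 else if 0 < (s : ℂ).re then 1 else 0
  have hinter : ∀ x, x ∈ U true → x ∈ U false → (x : ℂ).re ≠ 0 := by
    rintro x (h | h) (h' | h')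
    · exact h
    · exact h
    · exact h'
    · exact absurd h (not_lt_of_gt (α := ℝ) h')
  have hev : ∀ x, x ∈ U true → x ∈ U false → ∀ᶠ y in 𝓝 x, ψ false y = ψ false x := by
    intro x h h'
    rcases (hinter x h h').lt_or_gt with h | h
    · filter_upwards [hre.continuousAt.eventually_lt continuousAt_const h] with y hy
      simp only [ψ, if_neg hy.not_gt, if_neg h.not_gt]
    · filter_upwards [continuousAt_const.eventually_lt hre.continuousAt h] with y hy
      simp only [ψ, if_pos hy, if_pos h]
  obtain ⟨f, hf, hfU⟩ := exists_cocycle ho hcov ψ (by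
    rintro (_ | _) (_ | _) x ⟨h, h'⟩
    · simp
    · filter_upwards [hev x h' h] with y hy
      rw [hy]; rfl
    · filter_upwards [hev x h h'] with y hy
      rw [hy]; rfl
    · simp)
  have him0 : ∀ a t, ((arc a t : Circle) : ℂ).im = Real.sin (Real.pi * (t 1 + a)) := fun a t => by
    change ((Circle.exp _ : Circle) : ℂ).im = _
    rw [Circle.coe_exp, Complex.exp_ofReal_mul_I_im]
  have hs : ∀ t : Simp 1, 0 ≤ Real.sin (Real.pi * t 1) := fun t => by
    refine Real.sin_nonneg_of_nonneg_of_le_pi (mul_nonneg Real.pi_pos.le (t.2.1 1)) ?_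
    exact mul_le_of_le_one_right Real.pi_pos.le (mem_Icc_of_mem_stdSimplex t.2 1).2
  have h0 : ∀ t, arc 0 t ∈ U true := fun t => by
    by_cases h : ((arc 0 t : Circle) : ℂ).re = 0
    · refine Or.inr (lt_of_le_of_ne ?_ (hsq _ h).symm)
      rw [him0, add_zero]
      exact hs t
    · exact Or.inl h
  have h1 : ∀ t, arc 1 t ∈ U false := fun t => by
    by_cases h : ((arc 1 t : Circle) : ℂ).re = 0
    · refine Or.inr (lt_of_le_of_ne ?_ (hsq _ h))
      rw [him0, mul_add, mul_one, Real.sin_add_pi]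
      exact neg_nonpos.2 (hs t)
    · exact Or.inl h
  refine ⟨f, hf, ?_⟩
  rw [circleCycle, map_add, hfU true _ h0, hfU false _ h1, cobd_single, cobd_single]
  have e1 : ψ false (arc 1 (vtx 1)) = 1 := by
    simp [ψ, arc, mul_add]
  have e2 : ψ false (arc 1 (vtx 0)) = 0 := by
    simp [ψ, arc, Circle.coe_exp]
  rw [e1, e2]
  simp [ψ]

theorem apply_push_const {X Y : Type*} [TopologicalSpace X] [TopologicalSpace Y]
    {f : SC 1 Y →ₗ[ℚ] ℚ} (hf : ∀ v : SC 2 Y, f (bd v) = 0) (y : Y) (u : SC 1 X) :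
    f (push (ContinuousMap.const X y) u) = 0 := by
  suffices H : f.comp (push (ContinuousMap.const X y)) = 0 from DFunLike.congr_fun H u
  refine hom_ext fun e => ?_
  have h : f (single (ContinuousMap.const (Simp 1) y) 1) =
      f (single (ContinuousMap.const (Simp 1) y) 1) +
        f (single (ContinuousMap.const (Simp 1) y) 1) :=
    cocycle_apply hf (ContinuousMap.const (Simp 2) y)
  rw [LinearMap.comp_apply, push_single]
  change f (single (ContinuousMap.const (Simp 1) y) 1) = 0
  linarith

end CircleCycle

theorem exists_nhds_extension {M : Type*} [TopologicalSpace M] [NormalSpace M] {F : Set M}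
    (hF : IsClosed F) (h : C(F, Circle)) : ∃ (N : Set M) (_ : IsOpen N) (hN : F ⊆ N)
      (r : C(N, Circle)), ∀ y : F, r ⟨y, hN y.2⟩ = h y := by
  obtain ⟨φ, hφ⟩ := ContinuousMap.exists_restrict_eq hF
    ((⟨(↑), continuous_subtype_val⟩ : C(Circle, ℂ)).comp h)
  have hφ' : ∀ y : F, φ y = h y := fun y => DFunLike.congr_fun hφ y
  refine ⟨{x | φ x ≠ 0}, isOpen_ne_fun φ.continuous continuous_const, fun x hx => ?_,
    ⟨fun x => ⟨φ x / ‖φ x‖, ?_⟩, ?_⟩, fun y => ?_⟩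
  · change φ x ≠ 0
    rw [hφ' ⟨x, hx⟩]
    exact Circle.coe_ne_zero _
  · refine mem_sphere_zero_iff_norm.2 ?_
    rw [norm_div, Complex.norm_real, norm_norm,
      div_self (norm_ne_zero_iff.2 x.2)]
  · refine continuous_induced_rng.2 ?_
    have h1 : Continuous fun x : {x | φ x ≠ 0} => φ x := φ.continuous.comp continuous_subtype_val
    exact h1.div (Complex.continuous_ofReal.comp h1.norm) fun x => by
      exact Complex.ofReal_ne_zero.2 (norm_ne_zero_iff.2 x.2)
  · ext
    change φ y / ‖φ y‖ = _
    rw [hφ', Circle.norm_coe]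
    simp

theorem two_mul_le_finrank {H : Type*} [AddCommGroup H] [Module ℚ H] [Module.Finite ℚ H] {n : ℕ}
    {v : Fin n → H} {F : Fin n → Module.Dual ℚ H} (hv : LinearIndependent ℚ v)
    (hF : LinearIndependent ℚ F) (h : ∀ i j, F i (v j) = 0) : 2 * n ≤ Module.finrank ℚ H := by
  have h1 := Subspace.finrank_add_finrank_dualCoannihilator_eq (Submodule.span ℚ (range F))
  have h2 : Submodule.span ℚ (range v) ≤ (Submodule.span ℚ (range F)).dualCoannihilator := by
    rw [Submodule.span_le]
    rintro _ ⟨j, rfl⟩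
    rw [SetLike.mem_coe, Submodule.mem_dualCoannihilator]
    intro φ hφ
    induction hφ using Submodule.span_induction with
    | mem φ hφ => obtain ⟨i, rfl⟩ := hφ; exact h i j
    | zero => rfl
    | add a b _ _ ha hb => rw [LinearMap.add_apply, ha, hb, add_zero]
    | smul c a _ ha => rw [LinearMap.smul_apply, ha, smul_zero]
  have h3 := Submodule.finrank_mono h2
  rw [finrank_span_eq_card hv, Fintype.card_fin] at h3
  rw [finrank_span_eq_card hF, Fintype.card_fin] at h1
  omega

end CircleCycles

section DisjointCircles

open Finsupp Set Topology

section Circles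

variable {M : Type*} [TopologicalSpace M] {F : Set M} {n : ℕ} (Φ : F ≃ₜ Fin n × Circle)

/-- The parametrization of one of the circles of a disjoint union of circles. -/
noncomputable def circ (j : Fin n) : C(Circle, M) where
  toFun s := Φ.symm (j, s)
  continuous_toFun := by fun_prop

/-- The cycle carried by one of the circles of a disjoint union of circles. -/
noncomputable def circCycle (j : Fin n) : SC 1 M := push (circ Φ j) circleCycle

theorem bd_circCycle (j : Fin n) : bd (circCycle Φ j) = 0 := by
  rw [circCycle, bd_push, bd_circleCycle, map_zero]

theorem circCycle_mem (j : Fin n) : circCycle Φ j ∈ Chn 1 (range (circ Φ j)) :=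
  push_mem (fun s _ => mem_range_self s) (mem_Chn_univ _)

theorem circ_mem (j : Fin n) (s : Circle) : circ Φ j s ∈ F := (Φ.symm (j, s)).2

theorem disjoint_range_circ {i j : Fin n} (h : i ≠ j) :
    Disjoint (range (circ Φ i)) (range (circ Φ j)) := by
  rw [disjoint_left]
  rintro _ ⟨s, rfl⟩ ⟨t, ht⟩
  exact h (congrArg Prod.fst (Φ.symm.injective (Subtype.ext ht))).symm

/-- The projection of a disjoint union of circles to one of them. -/
noncomputable def circProj (j : Fin n) : C(F, Circle) where
  toFun y := if (Φ y).1 = j then (Φ y).2 else 1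
  continuous_toFun := by
    have h : Continuous fun p : Fin n × Circle => if p.1 = j then p.2 else 1 := by
      refine Continuous.if (fun p hp => ?_) continuous_snd continuous_const
      have hc : IsClopen {p : Fin n × Circle | p.1 = j} :=
        (isClopen_discrete {j}).preimage continuous_fst
      rw [hc.frontier_eq] at hp
      exact hp.elim
    exact h.comp Φ.continuous

variable [T2Space M] [CompactSpace M] {z : SC 2 M}

theorem coeff_eq_zero (hM : PlaneCovered M)
    (hz : IsFund z) (hF : IsClosed F) (hA : IsPreconnected Fᶜ) {a : Fin n → ℚ} {w : SC 2 M}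
    (h : bd w = ∑ j, a j • circCycle Φ j) (j : Fin n) : a j = 0 := by
  have hbd : ∀ x ∈ Fᶜ, bd w ∈ Chn 1 {x}ᶜ := by
    intro x hx
    rw [h]
    refine Submodule.sum_mem _ fun i _ => Submodule.smul_mem _ _ (Chn_mono ?_ (circCycle_mem Φ i))
    rintro _ ⟨s, rfl⟩ rfl
    exact hx (circ_mem Φ i s)
  obtain ⟨q, hq⟩ : ∃ q : ℚ, ∀ x ∈ Fᶜ, w - q • z ∈ Null 2 {x} := by
    rcases (Fᶜ).eq_empty_or_nonempty with he | ⟨x₀, hx₀⟩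
    · exact ⟨0, by simp [he]⟩
    · refine ⟨deg z x₀ w, fun x hx => ?_⟩
      rw [deg_eq_of_isPreconnected hM hz hA _ hx₀ hx]
      · exact deg_spec hM hz (hbd x hx)
      · rw [h, compl_compl]
        refine Submodule.sum_mem _ fun i _ => Submodule.smul_mem _ _
          (Chn_mono (range_subset_iff.2 (circ_mem Φ i)) (circCycle_mem Φ i))
  obtain ⟨N, hN, hFN, r, hr⟩ := exists_nhds_extension hF (circProj Φ j)
  obtain ⟨v, o, ho, hvo⟩ := mem_Null.1 (Null_of_points hM hN.isClosed_compl.isCompact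
    fun x hx => hq x fun hxF => hx (hFN hxF))
  rw [compl_compl] at ho
  let ι : C(N, M) := ⟨Subtype.val, continuous_subtype_val⟩
  have hι : IsOpenEmbedding ι := hN.isOpenEmbedding_subtypeVal
  obtain ⟨o', -, rfl⟩ := exists_push hι (S := univ) (u := o) (by
    rw [inter_univ]
    simpa [ι] using ho)
  let γ : Fin n → C(Circle, N) := fun i => ⟨fun s => ⟨circ Φ i s, hFN (circ_mem Φ i s)⟩,
    (circ Φ i).continuous.subtype_mk _⟩
  have hbo : bd o' = ∑ i, a i • push (γ i) circleCycle := by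
    apply push_injective hι
    rw [← bd_push, map_sum]
    have e1 : ∀ i, push ι (a i • push (γ i) circleCycle) = a i • circCycle Φ i := fun i => by
      rw [map_smul, push_push]; rfl
    rw [Finset.sum_congr rfl fun i _ => e1 i, ← h]
    have e2 := congrArg bd hvo
    rw [map_sub, map_smul, hz.bd_eq, smul_zero, sub_zero, map_add, bd_bd, zero_add] at e2
    exact e2.symm
  obtain ⟨f, hf, hf1⟩ := exists_circle_cocycle
  have h0 : f (push r (bd o')) = 0 := by rw [← bd_push]; exact hf _
  have hproj : ∀ i s, r (γ i s) = if i = j then s else 1 := fun i s => by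
    rw [show γ i s = ⟨(Φ.symm (i, s) : F), hFN (Φ.symm (i, s)).2⟩ from rfl, hr]
    simp [circProj]
  have hcoef : ∀ i, f (push r (a i • push (γ i) circleCycle)) = if i = j then a j else 0 := by
    intro i
    rw [map_smul, push_push, map_smul]
    split_ifs with hij
    · have : r.comp (γ i) = ContinuousMap.id Circle := by
        ext1 s; simpa [hij] using hproj i s
      rw [this, push_id, hf1, hij, smul_eq_mul, mul_one]
    · have : r.comp (γ i) = ContinuousMap.const Circle 1 := by
        ext1 s; simpa [hij] using hproj i s
      rw [this, apply_push_const hf, smul_zero]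
  rw [hbo, map_sum, map_sum, Finset.sum_congr rfl fun i _ => hcoef i] at h0
  simpa using h0

theorem two_mul_le_finrank_HOne (Φ : F ≃ₜ Fin n × Circle) (hM : PlaneCovered M)
    (hz : IsFund z) (hF : IsClosed F) (hA : IsPreconnected Fᶜ) :
    2 * n ≤ Module.finrank ℚ (HOne M) := by
  have := finite_HOne hM hz
  have hcl : ∀ j, IsClosed (range (circ Φ j)) := fun j =>
    (isCompact_range (circ Φ j).continuous).isClosed
  choose f hf hf0 hfz using fun j =>
    exists_dual hM hz (bd_circCycle Φ j) (hcl j) (circCycle_mem Φ j)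
  have hfc : ∀ i j, f i (circCycle Φ j) = 0 := by
    intro i j
    by_cases hij : i = j
    · subst hij
      obtain ⟨v, hv⟩ := hfz i
      rw [← sub_sub_cancel (capTwo (f i) z) (circCycle Φ i), hv, map_sub, hf,
        apply_capTwo_self (hf i) hz.bd_eq, sub_zero]
    · refine eq_of_supported (f i) 0 (fun e he => ?_) (circCycle_mem Φ j)
      exact hf0 i e fun t => disjoint_right.1 (disjoint_range_circ Φ hij) (he t)
  let v : Fin n → HOne M := fun j => Submodule.Quotient.mk ⟨circCycle Φ j, bd_circCycle Φ j⟩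
  let G : Fin n → Module.Dual ℚ (HOne M) := fun j =>
    Submodule.liftQ _ ((f j).comp (LinearMap.ker bd).subtype) (by
      rintro ⟨u, hu⟩ ⟨w, rfl⟩
      exact hf j w)
  refine two_mul_le_finrank (v := v) (F := G) ?_ ?_ fun i j => hfc i j
  · rw [Fintype.linearIndependent_iff]
    intro a ha
    have hmk : ∑ j, a j • v j = Submodule.Quotient.mk
        (∑ j, a j • (⟨circCycle Φ j, bd_circCycle Φ j⟩ : LinearMap.ker (bd : SC 1 M →ₗ[ℚ] _))) := by
      rw [← Submodule.mkQ_apply, map_sum]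
      rfl
    rw [hmk, Submodule.Quotient.mk_eq_zero] at ha
    obtain ⟨w, hw⟩ := ha
    exact coeff_eq_zero Φ hM hz hF hA (w := w) (by rw [hw]; simp)
  · rw [Fintype.linearIndependent_iff]
    intro a ha
    have hker : LinearMap.ker (bd : SC 1 M →ₗ[ℚ] SC 0 M) ≤ LinearMap.ker (∑ j, a j • f j) := by
      intro u hu
      have := DFunLike.congr_fun ha (Submodule.Quotient.mk ⟨u, hu⟩)
      simpa [G, LinearMap.sum_apply] using this
    obtain ⟨φ, hφ⟩ := exists_comp_eq_of_ker_le bd (∑ j, a j • f j) hker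
    choose u hu using hfz
    have hco : ∀ e, (∑ j, a j • f j) (single e 1) = cobd (fun x => φ (single (pt x) 1))
        (single e 1) := fun e => by
      rw [hφ, bd_single_one, map_sub, face_one_eq, face_one_eq, cobd_single]
      rfl
    have hcap : ∑ j, a j • capTwo (f j) z = capTwo (cobd fun x => φ (single (pt x) 1)) z := by
      suffices H : ∑ j, a j • capTwo (f j) = capTwo (cobd fun x => φ (single (pt x) 1)) by
        rw [← H]; simp [LinearMap.sum_apply]
      refine hom_ext fun σ => ?_
      rw [capTwo_single, ← hco]
      simp [LinearMap.sum_apply, capTwo_single, Finset.sum_smul, mul_smul]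
    refine coeff_eq_zero Φ hM hz hF hA
      (w := capZero (fun x => φ (single (pt x) 1)) z - ∑ j, a j • u j) ?_
    rw [map_sub, bd_capZero _ hz.bd_eq, ← hcap, map_sum, ← Finset.sum_sub_distrib]
    refine Finset.sum_congr rfl fun j _ => ?_
    rw [map_smul, ← hu, ← smul_sub, sub_sub_cancel]

end Circles

end DisjointCircles

section MathlibComparison

open Finsupp Set Topology

section Comparison

variable (X : Type) [TopologicalSpace X]

/-- The short complex of singular chains around a positive degree. -/
noncomputable def chainTriple (n : ℕ) : ShortComplex (ModuleCat ℚ) :=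
  ShortComplex.mk (ModuleCat.ofHom (bd : SC (n + 2) X →ₗ[ℚ] SC (n + 1) X))
    (ModuleCat.ofHom (bd : SC (n + 1) X →ₗ[ℚ] SC n X)) (by
      ext1
      exact LinearMap.ext bd_bd)

/-- Singular chains as continuous maps on simplices. -/
noncomputable def chainIso (n : ℕ) :
    ((singularChainComplex ℚ).obj (TopCat.of X)).X n ≅ ModuleCat.of ℚ (SC n X) :=
  LinearEquiv.toModuleIso (Finsupp.domLCongr
    (TopCat.toSSetObjEquiv (TopCat.of X) (Opposite.op (SimplexCategory.mk n))))

/-- The alternating sum of the faces, on formal combinations of singular simplices. -/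
noncomputable def faceSum (n : ℕ) :
    ((TopCat.toSSet.obj (TopCat.of X)).obj (Opposite.op (SimplexCategory.mk (n + 1))) →₀ ℚ) →ₗ[ℚ]
      ((TopCat.toSSet.obj (TopCat.of X)).obj (Opposite.op (SimplexCategory.mk n)) →₀ ℚ) :=
  ∑ i : Fin (n + 2), (-1 : ℤ) ^ (i : ℕ) • Finsupp.lmapDomain ℚ ℚ
    ((TopCat.toSSet.obj (TopCat.of X)).δ i)

theorem singularChainComplex_d (n : ℕ) :
    ((singularChainComplex ℚ).obj (TopCat.of X)).d (n + 1) n =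
      ModuleCat.ofHom (faceSum X n) := by
  refine (AlgebraicTopology.AlternatingFaceMapComplex.obj_d_eq
    (((SimplicialObject.whiskering _ _).obj (ModuleCat.free ℚ)).obj
      (TopCat.toSSet.obj (TopCat.of X))) n).trans ?_
  apply ModuleCat.hom_ext
  exact (ModuleCat.hom_sum _ _).trans (Finset.sum_congr rfl fun i _ => ModuleCat.hom_zsmul _ _)

theorem chainIso_comm (n : ℕ) :
    (chainIso X (n + 1)).hom ≫ ModuleCat.ofHom bd =
      ((singularChainComplex ℚ).obj (TopCat.of X)).d (n + 1) n ≫ (chainIso X n).hom := by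
  rw [singularChainComplex_d]
  let E : ∀ m, ((TopCat.toSSet.obj (TopCat.of X)).obj (Opposite.op (SimplexCategory.mk m)) →₀ ℚ)
      →ₗ[ℚ] SC m X := fun m => (Finsupp.domLCongr (R := ℚ) (M := ℚ)
    (TopCat.toSSetObjEquiv (TopCat.of X) (Opposite.op (SimplexCategory.mk m)))).toLinearMap
  change ModuleCat.ofHom ((bd : SC (n + 1) X →ₗ[ℚ] SC n X).comp (E (n + 1))) =
    ModuleCat.ofHom ((E n).comp (faceSum X n))
  refine congrArg ModuleCat.ofHom (hom_ext fun s => ?_)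
  have hE : ∀ m s, E m (single s 1) = single
      (TopCat.toSSetObjEquiv (TopCat.of X) (Opposite.op (SimplexCategory.mk m)) s) 1 :=
    fun m s => Finsupp.domLCongr_single _ _ _
  rw [LinearMap.comp_apply, LinearMap.comp_apply, hE, faceSum, LinearMap.sum_apply, map_sum]
  refine (bd_single _).trans (Finset.sum_congr rfl fun i _ => ?_)
  rw [LinearMap.smul_apply, map_zsmul, Finsupp.lmapDomain_apply, Finsupp.mapDomain_single, hE,
    ← Int.cast_smul_eq_zsmul ℚ]
  push_cast
  rfl

/-- The comparison of the two short complexes of singular chains. -/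
noncomputable def tripleIso (n : ℕ) :
    ((singularChainComplex ℚ).obj (TopCat.of X)).sc' (n + 2) (n + 1) n ≅ chainTriple X n :=
  ShortComplex.isoMk (chainIso X (n + 2)) (chainIso X (n + 1)) (chainIso X n)
    (chainIso_comm X (n + 1)) (chainIso_comm X n)

theorem exists_singularHomology_equiv (n : ℕ) :
    Nonempty ((singularHomology ℚ (n + 1)).obj (TopCat.of X) ≃ₗ[ℚ]
      LinearMap.ker (bd : SC (n + 1) X →ₗ[ℚ] SC n X) ⧸
        (LinearMap.range (bd : SC (n + 2) X →ₗ[ℚ] SC (n + 1) X)).comap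
          (LinearMap.ker bd).subtype) := by
  let e : (singularHomology ℚ (n + 1)).obj (TopCat.of X) ≅
      (chainTriple X n).moduleCatLeftHomologyData.H :=
    ((singularChainComplex ℚ).obj (TopCat.of X)).homologyIsoSc' (n + 2) (n + 1) n
      (ChainComplex.prev ℕ (n + 1)) (ChainComplex.next_nat_succ n) ≪≫
    ShortComplex.homologyMapIso (tripleIso X n) ≪≫ (chainTriple X n).moduleCatHomologyIso
  refine ⟨e.toLinearEquiv.trans (Submodule.quotEquivOfEq _ _ ?_)⟩
  ext u
  exact ⟨fun ⟨v, hv⟩ => ⟨v, congrArg Subtype.val hv⟩, fun ⟨v, hv⟩ => ⟨v, Subtype.ext hv⟩⟩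

theorem bettiNumber_one_eq : bettiNumber ℚ 1 X = Module.finrank ℚ (HOne X) :=
  (exists_singularHomology_equiv X 0).some.finrank_eq

theorem exists_cycle_of_bettiNumber_two (h : bettiNumber ℚ 2 X = 1) :
    ∃ z : SC 2 X, bd z = 0 ∧ ∀ v, z ≠ bd v := by
  have h1 := (exists_singularHomology_equiv X 1).some.finrank_eq.symm.trans h
  have : Nontrivial _ := Module.nontrivial_of_finrank_pos (R := ℚ) (h1 ▸ Nat.one_pos)
  obtain ⟨c, hc⟩ := exists_ne (0 : LinearMap.ker (bd : SC 2 X →ₗ[ℚ] SC 1 X) ⧸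
    (LinearMap.range (bd : SC 3 X →ₗ[ℚ] SC 2 X)).comap (LinearMap.ker bd).subtype)
  obtain ⟨z, rfl⟩ := Submodule.Quotient.mk_surjective _ c
  exact ⟨z, z.2, fun v hv => hc ((Submodule.Quotient.mk_eq_zero _).2 ⟨v, hv.symm⟩)⟩

end Comparison

end MathlibComparison

end SurfaceHomology

/-- Let `X` be a closed connected orientable surface of genus `g` (encoded as a compact
connected Hausdorff topological 2-manifold with rational Betti numbers `b₁ = 2g`,
`b₂ = 1`), and let `σ` be a continuous involution of `X` whose fixed-point set is a
disjoint union of `g+1` circles. Then the complement of the fixed-point set is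
disconnected. -/
theorem complement_of_fixed_locus_disconnected (g : ℕ) (X : Type) [TopologicalSpace X]
    [T2Space X] [CompactSpace X] [ConnectedSpace X]
    [ChartedSpace (EuclideanSpace ℝ (Fin 2)) X]
    (hb1 : bettiNumber ℚ 1 X = 2 * g) (hb2 : bettiNumber ℚ 2 X = 1)
    (σ : X → X) (hσc : Continuous σ) (hσ2 : σ ∘ σ = id)
    (hfix : Nonempty ({x : X // σ x = x} ≃ₜ Fin (g + 1) × Circle)) :
    ¬ IsPreconnected ({x : X | σ x = x}ᶜ) := by
  intro hA
  obtain ⟨Φ⟩ := hfix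
  obtain ⟨z, hz, hv⟩ := SurfaceHomology.exists_cycle_of_bettiNumber_two X hb2
  have hM : SurfaceHomology.PlaneCovered X := SurfaceHomology.planeCovered_of_chartedSpace
  have h := SurfaceHomology.two_mul_le_finrank_HOne (F := {x : X | σ x = x}) Φ hM
    (SurfaceHomology.isFund_of_not_bd hM hz hv) (isClosed_eq hσc continuous_id) hA
  rw [← SurfaceHomology.bettiNumber_one_eq, hb1] at h
  omega
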